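/- Every planar 3-tree on n vertices admits a plane arc diagram with at most ⌊3(n−3)/4⌋ biarcs such that every biarc is a down-up monotone biarc. -/

import Mathlib

open Set Bornology

noncomputable section

/-! ### Plane drawings, planarity, and triangulations

A drawing of a simple graph in the plane: vertices are distinct points, edges are
simple continuous curves between their endpoints, interiors of edges avoid vertices,
and distinct edges have disjoint interiors (no two edges cross or touch). -/

structure PlaneDrawing {V : Type} (G : SimpleGraph V) where
  vert : V → ℝ × ℝ
  edge : Sym2 V → ℝ → ℝ × ℝ
  vert_inj : Function.Injective vert
  edge_cont : ∀ e ∈ G.edgeSet, ContinuousOn (edge e) (Set.Icc 0 1)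
  edge_injOn : ∀ e ∈ G.edgeSet, Set.InjOn (edge e) (Set.Icc 0 1)
  edge_ends : ∀ a b : V, G.Adj a b →
    ({edge s(a, b) 0, edge s(a, b) 1} : Set (ℝ × ℝ)) = {vert a, vert b}
  edge_int_vert : ∀ e ∈ G.edgeSet, ∀ x : V, vert x ∉ edge e '' Set.Ioo 0 1
  edge_disjoint : ∀ e ∈ G.edgeSet, ∀ f ∈ G.edgeSet, e ≠ f →
    edge e '' Set.Ioo 0 1 ∩ edge f '' Set.Ioo 0 1 = ∅

/-- A graph is planar if it admits a crossing-free drawing in the plane. -/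
def IsPlanar {V : Type} (G : SimpleGraph V) : Prop := Nonempty (PlaneDrawing G)

/-- A (plane) triangulation: a maximal planar graph on at least three vertices. -/
def IsTriangulation {V : Type} [Fintype V] (G : SimpleGraph V) : Prop :=
  3 ≤ Fintype.card V ∧ IsPlanar G ∧
    ∀ a b : V, a ≠ b → ¬ G.Adj a b →
      ¬ IsPlanar (G ⊔ SimpleGraph.fromEdgeSet {s(a, b)})

/-- The edges of `G` with both endpoints in `W`. -/
def edgesWithin {V : Type} (G : SimpleGraph V) (W : Set V) : Set (Sym2 V) :=
  {e | e ∈ G.edgeSet ∧ ∀ x ∈ e, x ∈ W}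

/-- The neighbours of `x` that lie in `W`. -/
def nbrsIn {V : Type} (G : SimpleGraph V) (W : Set V) (x : V) : Set V :=
  {y | y ∈ W ∧ G.Adj x y}

namespace PlaneDrawing

variable {V : Type} {G : SimpleGraph V}

def edgeImage (D : PlaneDrawing G) (e : Sym2 V) : Set (ℝ × ℝ) :=
  D.edge e '' Set.Icc 0 1

/-- The union of all vertex points and edge curves of the sub-drawing induced by `W`. -/
def imageOn (D : PlaneDrawing G) (W : Set V) : Set (ℝ × ℝ) :=
  D.vert '' W ∪ ⋃ e ∈ edgesWithin G W, D.edgeImage e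

/-- The outer face `F∘` of the sub-drawing induced by `W`: the union of the unbounded
connected components of the complement of the drawing. -/
def outerRegion (D : PlaneDrawing G) (W : Set V) : Set (ℝ × ℝ) :=
  {p | p ∉ D.imageOn W ∧ ¬ IsBounded (connectedComponentIn (D.imageOn W)ᶜ p)}

/-- The vertex `x` lies on the boundary cycle `C∘` of the outer face of `G[W]`. -/
def OnOuterVertex (D : PlaneDrawing G) (W : Set V) (x : V) : Prop :=
  D.vert x ∈ frontier (D.outerRegion W)

/-- The edge `e` lies on the boundary cycle `C∘` of the outer face of `G[W]`. -/
def OnOuterEdge (D : PlaneDrawing G) (W : Set V) (e : Sym2 V) : Prop :=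
  e ∈ edgesWithin G W ∧ D.edgeImage e ⊆ frontier (D.outerRegion W)

/-- The triangle `abc` bounds a face of the full drawing. -/
def IsFacialTriangle (D : PlaneDrawing G) (a b c : V) : Prop :=
  G.Adj a b ∧ G.Adj b c ∧ G.Adj a c ∧
    ∃ p, p ∉ D.imageOn Set.univ ∧
      frontier (connectedComponentIn (D.imageOn Set.univ)ᶜ p) =
        D.edgeImage s(a, b) ∪ D.edgeImage s(b, c) ∪ D.edgeImage s(a, c)

/-- Every inner (bounded) face of the sub-drawing induced by `W` is bounded by a
triangle of `G[W]`. -/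
def InnerFacesTriangulated (D : PlaneDrawing G) (W : Set V) : Prop :=
  ∀ p, p ∉ D.imageOn W → IsBounded (connectedComponentIn (D.imageOn W)ᶜ p) →
    ∃ a ∈ W, ∃ b ∈ W, ∃ c ∈ W, G.Adj a b ∧ G.Adj b c ∧ G.Adj a c ∧
      frontier (connectedComponentIn (D.imageOn W)ᶜ p) =
        D.edgeImage s(a, b) ∪ D.edgeImage s(b, c) ∪ D.edgeImage s(a, c)

end PlaneDrawing

/-- A graph is biconnected if it is connected and has no cut vertex. -/
def Biconnected {α : Type} (H : SimpleGraph α) : Prop :=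
  H.Connected ∧ ∀ x : α, (H.induce {y | y ≠ x}).Connected

/-- The subgraph of `G` induced by `W` (with the drawing `D`) is internally
triangulated: biconnected and every inner face is a triangle. -/
def InternallyTriangulatedOn {V : Type} {G : SimpleGraph V}
    (D : PlaneDrawing G) (W : Set V) : Prop :=
  Biconnected (G.induce W) ∧ D.InnerFacesTriangulated W

/-! ### Canonical orderings -/

/-- The vertex set `V_i = {v 1, …, v i}`. -/
def Vset {V : Type} (v : ℕ → V) (i : ℕ) : Set V := v '' Set.Icc 1 i

/-- `v 1, …, v i` is a canonical ordering for `G_i` (conditions (C1)–(C3)). -/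
def IsCanonicalOrdering {V : Type} {G : SimpleGraph V} (D : PlaneDrawing G)
    (i : ℕ) (v : ℕ → V) : Prop :=
  3 ≤ i ∧ Set.InjOn v (Set.Icc 1 i) ∧ G.Adj (v 1) (v 2) ∧
    ∀ m, 3 ≤ m → m ≤ i →
      InternallyTriangulatedOn D (Vset v m) ∧
      D.OnOuterEdge (Vset v m) s(v 1, v 2) ∧
      ∀ j, m < j → j ≤ i → D.vert (v j) ∈ D.outerRegion (Vset v m)

/-- The canonical ordering `v 1, …, v i` is extensible: it can be completed to a
canonical ordering of the whole graph. -/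
def ExtensibleOrd {V : Type} [Fintype V] {G : SimpleGraph V} (D : PlaneDrawing G)
    (i : ℕ) (v : ℕ → V) : Prop :=
  ∃ w : ℕ → V, (∀ m, 1 ≤ m → m ≤ i → w m = v m) ∧
    Set.BijOn w (Set.Icc 1 (Fintype.card V)) Set.univ ∧
    IsCanonicalOrdering D (Fintype.card V) w

/-- Append `x` to the sequence `v` at position `i + 1`. -/
def extendSeq {V : Type} (v : ℕ → V) (i : ℕ) (x : V) : ℕ → V :=
  fun m => if m = i + 1 then x else v m

/-- A vertex `x ∉ V_i` is eligible for `G_i` if appending it yields an extensible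
canonical ordering for `G_{i+1}`. -/
def Eligible {V : Type} [Fintype V] {G : SimpleGraph V} (D : PlaneDrawing G)
    (i : ℕ) (v : ℕ → V) (x : V) : Prop :=
  x ∉ Vset v i ∧ IsCanonicalOrdering D (i + 1) (extendSeq v i x) ∧
    ExtensibleOrd D (i + 1) (extendSeq v i x)

open Classical in
/-- The region `R_i(x)` associated to a vertex `x ∉ W` (with `W = V_i`): the outer
face of `G[W]` if `x` has at most one neighbour in `W`, and otherwise the part of the
outer face cut off from infinity by the edges from `x` to its neighbours on the
outer path. -/
def Rregion {V : Type} {G : SimpleGraph V} (D : PlaneDrawing G)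
    (W : Set V) (x : V) : Set (ℝ × ℝ) :=
  if (nbrsIn G W x).Subsingleton then D.outerRegion W
  else
    {p | p ∈ D.outerRegion W ∧
      p ∉ (⋃ y ∈ nbrsIn G W x, D.edgeImage s(x, y)) ∧
      IsBounded (connectedComponentIn
        (D.imageOn W ∪ ⋃ y ∈ nbrsIn G W x, D.edgeImage s(x, y))ᶜ p)}

/-- The open region `X_j` spanned by `u` and the part of the outer path between two
consecutive neighbours `a`, `b` of `u`. -/
def Xregion {V : Type} {G : SimpleGraph V} (D : PlaneDrawing G)
    (W : Set V) (u a b : V) : Set (ℝ × ℝ) :=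
  {p | p ∈ D.outerRegion W ∧
    p ∉ D.edgeImage s(u, a) ∪ D.edgeImage s(u, b) ∧
    IsBounded (connectedComponentIn
      (D.imageOn W ∪ D.edgeImage s(u, a) ∪ D.edgeImage s(u, b))ᶜ p)}

/-! ### Arc diagrams

Vertices are placed on a horizontal spine.  Every edge is drawn as a *mountain*
(a proper arc, i.e. halfcircle, above the spine), a *pocket* (a proper arc below the
spine), or a *down-up biarc* (two halfcircles, crossing the spine exactly once, the
left halfcircle below and the right halfcircle above the spine).  In particular all
edges are x-monotone and every biarc is down-up monotone.  Each edge also carries an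
amount of credits (used only for the credit-scheme lemmas). -/

inductive ArcKind : Type
  | mountain
  | pocket
  | biarc
deriving DecidableEq

structure ArcDiagram (V : Type) where
  pos : V → ℝ
  kind : Sym2 V → ArcKind
  crossPt : Sym2 V → ℝ
  credit : Sym2 V → ℝ

/-- Two intervals interleave (so that halfcircles over them on the same side of the
spine cross). -/
def Interleaved (p q : ℝ × ℝ) : Prop := p.1 < q.1 ∧ q.1 < p.2 ∧ p.2 < q.2

/-- The height above (or depth below) the spine, at abscissa `x`, of the halfcircle
with diameter from `l` to `r` centered on the spine. -/
def arcHeight (l r x : ℝ) : ℝ := Real.sqrt (((r - l) / 2) ^ 2 - (x - (l + r) / 2) ^ 2)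

namespace ArcDiagram

variable {V : Type}

def lo (A : ArcDiagram V) (e : Sym2 V) : ℝ :=
  Sym2.lift ⟨fun a b => min (A.pos a) (A.pos b), fun _ _ => min_comm _ _⟩ e

def hi (A : ArcDiagram V) (e : Sym2 V) : ℝ :=
  Sym2.lift ⟨fun a b => max (A.pos a) (A.pos b), fun _ _ => max_comm _ _⟩ e

/-- The halfcircles of the edge `e` above the spine (as intervals on the spine). -/
def upperArcs (A : ArcDiagram V) (e : Sym2 V) : List (ℝ × ℝ) :=
  match A.kind e with
  | ArcKind.mountain => [(A.lo e, A.hi e)]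
  | ArcKind.pocket => []
  | ArcKind.biarc => [(A.crossPt e, A.hi e)]

/-- The halfcircles of the edge `e` below the spine (as intervals on the spine). -/
def lowerArcs (A : ArcDiagram V) (e : Sym2 V) : List (ℝ × ℝ) :=
  match A.kind e with
  | ArcKind.mountain => []
  | ArcKind.pocket => [(A.lo e, A.hi e)]
  | ArcKind.biarc => [(A.lo e, A.crossPt e)]

/-- `A` is a plane arc diagram of the subgraph of `G` induced by `W`: vertex
positions on the spine are distinct, spine crossings of biarcs are in the interior
of the edge's span and distinct from all vertices and from each other, and no two
halfcircles on the same side of the spine cross. -/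
def IsPlaneOn (A : ArcDiagram V) (G : SimpleGraph V) (W : Set V) : Prop :=
  Set.InjOn A.pos W ∧
  (∀ e ∈ edgesWithin G W, A.kind e = ArcKind.biarc →
      A.lo e < A.crossPt e ∧ A.crossPt e < A.hi e ∧ ∀ x ∈ W, A.crossPt e ≠ A.pos x) ∧
  (∀ e ∈ edgesWithin G W, ∀ f ∈ edgesWithin G W, e ≠ f →
      A.kind e = ArcKind.biarc → A.kind f = ArcKind.biarc → A.crossPt e ≠ A.crossPt f) ∧
  (∀ e ∈ edgesWithin G W, ∀ f ∈ edgesWithin G W, e ≠ f →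
      (∀ p ∈ A.upperArcs e, ∀ q ∈ A.upperArcs f, ¬ Interleaved p q) ∧
      (∀ p ∈ A.lowerArcs e, ∀ q ∈ A.lowerArcs f, ¬ Interleaved p q))

/-- The number of biarcs of the diagram (on the subgraph induced by `W`). -/
def biarcCount (A : ArcDiagram V) (G : SimpleGraph V) (W : Set V) : ℕ :=
  {e | e ∈ edgesWithin G W ∧ A.kind e = ArcKind.biarc}.ncard

/-- The cost of the diagram: the total amount of credits on its edges. -/
def cost (A : ArcDiagram V) (G : SimpleGraph V) (W : Set V) : ℝ :=
  ∑ᶠ e ∈ edgesWithin G W, A.credit e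

/-- The edge `e` is (partly) vertically visible from above. -/
def OnUpperEnvelope (A : ArcDiagram V) (G : SimpleGraph V) (W : Set V)
    (e : Sym2 V) : Prop :=
  e ∈ edgesWithin G W ∧ ∃ p ∈ A.upperArcs e, ∃ x : ℝ, p.1 < x ∧ x < p.2 ∧
    ∀ f ∈ edgesWithin G W, f ≠ e → ∀ q ∈ A.upperArcs f, q.1 < x → x < q.2 →
      arcHeight q.1 q.2 x < arcHeight p.1 p.2 x

/-- The edge `e` is (partly) vertically visible from below. -/
def OnLowerEnvelope (A : ArcDiagram V) (G : SimpleGraph V) (W : Set V)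
    (e : Sym2 V) : Prop :=
  e ∈ edgesWithin G W ∧ ∃ p ∈ A.lowerArcs e, ∃ x : ℝ, p.1 < x ∧ x < p.2 ∧
    ∀ f ∈ edgesWithin G W, f ≠ e → ∀ q ∈ A.lowerArcs f, q.1 < x → x < q.2 →
      arcHeight q.1 q.2 x < arcHeight p.1 p.2 x

end ArcDiagram

/-! ### The invariants (I1)–(I5) of valid resp. extensible arc diagrams -/

/-- Invariants (I1)–(I4): `A` is a valid arc diagram for the subgraph of `G` induced
by `W` (relative to the plane embedding `D` of `G`, the starting vertices `v1, v2`,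
and the constant `χ`).  (I1) every edge is a proper arc or a down-up biarc and every
edge on the upper envelope is a proper arc; (I2) every mountain whose left endpoint
lies on `C∘(G[W]) \ {v2}` carries one credit; (I3) every biarc carries one credit;
(I4) every pocket on `P∘(G[W])` carries `χ` credits. -/
def ValidDiagram {V : Type} {G : SimpleGraph V} (D : PlaneDrawing G)
    (W : Set V) (v1 v2 : V) (χ : ℝ) (A : ArcDiagram V) : Prop :=
  A.IsPlaneOn G W ∧
  (∀ e ∈ edgesWithin G W, 0 ≤ A.credit e) ∧
  (∀ e, A.OnUpperEnvelope G W e → A.kind e ≠ ArcKind.biarc) ∧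
  (∀ a b : V, a ∈ W → b ∈ W → G.Adj a b → A.kind s(a, b) = ArcKind.mountain →
      A.pos a < A.pos b → D.OnOuterVertex W a → a ≠ v2 → 1 ≤ A.credit s(a, b)) ∧
  (∀ e ∈ edgesWithin G W, A.kind e = ArcKind.biarc → 1 ≤ A.credit e) ∧
  (∀ e ∈ edgesWithin G W, A.kind e = ArcKind.pocket → D.OnOuterEdge W e →
      e ≠ s(v1, v2) → χ ≤ A.credit e)

/-- Invariants (I1)–(I5): additionally `v1` is leftmost and `v2` rightmost on the
spine, the edge `v1 v2` forms the lower envelope, and the edges of `P∘(G[W])` form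
the upper envelope. -/
def ExtensibleDiagram {V : Type} {G : SimpleGraph V} (D : PlaneDrawing G)
    (W : Set V) (v1 v2 : V) (χ : ℝ) (A : ArcDiagram V) : Prop :=
  ValidDiagram D W v1 v2 χ A ∧ v1 ∈ W ∧ v2 ∈ W ∧
  (∀ w ∈ W, w ≠ v1 → A.pos v1 < A.pos w) ∧
  (∀ w ∈ W, w ≠ v2 → A.pos w < A.pos v2) ∧
  (∀ e ∈ edgesWithin G W, (A.OnLowerEnvelope G W e ↔ e = s(v1, v2))) ∧
  (∀ e ∈ edgesWithin G W, (A.OnUpperEnvelope G W e ↔ D.OnOuterEdge W e ∧ e ≠ s(v1, v2)))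

/-! ### Profiles, problematic vertices, pivots and the covering relation -/

/-- `x` has type `T(2, ⌢)`: degree two in `G_{i+1}` and its profile is a single
mountain. -/
def TypeT2 {V : Type} (A : ArcDiagram V) (G : SimpleGraph V) (W : Set V)
    (x : V) : Prop :=
  ∃ a b : V, nbrsIn G W x = {a, b} ∧ A.pos a < A.pos b ∧ G.Adj a b ∧
    A.kind s(a, b) = ArcKind.mountain

/-- `x` has type `T(3, ⌢⌢)`. -/
def TypeT3mm {V : Type} (A : ArcDiagram V) (G : SimpleGraph V) (W : Set V)
    (x : V) : Prop :=
  ∃ a b c : V, nbrsIn G W x = {a, b, c} ∧ A.pos a < A.pos b ∧ A.pos b < A.pos c ∧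
    G.Adj a b ∧ G.Adj b c ∧
    A.kind s(a, b) = ArcKind.mountain ∧ A.kind s(b, c) = ArcKind.mountain

/-- `x` has type `T(4, ⌢⌢⌢)`. -/
def TypeT4 {V : Type} (A : ArcDiagram V) (G : SimpleGraph V) (W : Set V)
    (x : V) : Prop :=
  ∃ a b c d : V, nbrsIn G W x = {a, b, c, d} ∧
    A.pos a < A.pos b ∧ A.pos b < A.pos c ∧ A.pos c < A.pos d ∧
    G.Adj a b ∧ G.Adj b c ∧ G.Adj c d ∧
    A.kind s(a, b) = ArcKind.mountain ∧ A.kind s(b, c) = ArcKind.mountain ∧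
    A.kind s(c, d) = ArcKind.mountain

/-- `x` has type `T(3, ⌢⌣)`. -/
def TypeT3ms {V : Type} (A : ArcDiagram V) (G : SimpleGraph V) (W : Set V)
    (x : V) : Prop :=
  ∃ a b c : V, nbrsIn G W x = {a, b, c} ∧ A.pos a < A.pos b ∧ A.pos b < A.pos c ∧
    G.Adj a b ∧ G.Adj b c ∧
    A.kind s(a, b) = ArcKind.mountain ∧ A.kind s(b, c) = ArcKind.pocket

/-- An eligible vertex is problematic if it has one of the four types
`T(2,⌢)`, `T(3,⌢⌢)`, `T(4,⌢⌢⌢)`, `T(3,⌢⌣)`. -/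
def Problematic {V : Type} (A : ArcDiagram V) (G : SimpleGraph V) (W : Set V)
    (x : V) : Prop :=
  TypeT2 A G W x ∨ TypeT3mm A G W x ∨ TypeT4 A G W x ∨ TypeT3ms A G W x

def HasLeftPivotType {V : Type} (A : ArcDiagram V) (G : SimpleGraph V) (W : Set V)
    (x : V) : Prop :=
  TypeT2 A G W x ∨ TypeT3mm A G W x ∨ TypeT4 A G W x

def HasRightPivotType {V : Type} (A : ArcDiagram V) (G : SimpleGraph V) (W : Set V)
    (x : V) : Prop :=
  TypeT3ms A G W x

def IsLeftmostNbr {V : Type} (A : ArcDiagram V) (G : SimpleGraph V) (W : Set V)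
    (x l : V) : Prop :=
  l ∈ nbrsIn G W x ∧ ∀ y ∈ nbrsIn G W x, A.pos l ≤ A.pos y

def IsRightmostNbr {V : Type} (A : ArcDiagram V) (G : SimpleGraph V) (W : Set V)
    (x r : V) : Prop :=
  r ∈ nbrsIn G W x ∧ ∀ y ∈ nbrsIn G W x, A.pos y ≤ A.pos r

/-- `q` is the pivot `p(x)` of the problematic vertex `x`: its rightmost neighbour on
the outer path if `x` has right pivot type `T(3,⌢⌣)`, its leftmost neighbour
otherwise. -/
def IsPivot {V : Type} (A : ArcDiagram V) (G : SimpleGraph V) (W : Set V)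
    (x q : V) : Prop :=
  (HasRightPivotType A G W x ∧ IsRightmostNbr A G W x q) ∨
  (HasLeftPivotType A G W x ∧ IsLeftmostNbr A G W x q)

/-- `z = pc(x)`: the vertex covering the pivot edge `x·p(x)`, i.e. the vertex outside
`W ∪ {x}` forming a triangular face of `G` with this edge. -/
def PivotCover {V : Type} {G : SimpleGraph V} (D : PlaneDrawing G) (A : ArcDiagram V)
    (W : Set V) (x z : V) : Prop :=
  z ∉ W ∧ z ≠ x ∧ ∃ q : V, IsPivot A G W x q ∧ D.IsFacialTriangle x q z

/-- `z` covers the edge `e` of the outer path: `z ∉ W` forms a triangular face of `G`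
with the two endpoints of `e`. -/
def CoversEdge {V : Type} {G : SimpleGraph V} (D : PlaneDrawing G)
    (W : Set V) (z : V) (e : Sym2 V) : Prop :=
  z ∉ W ∧ ∃ a b : V, e = s(a, b) ∧ D.IsFacialTriangle a b z

/-- `a` and `b` are consecutive neighbours (from left to right) of `x` in `W`. -/
def ConsecNbrs {V : Type} (A : ArcDiagram V) (G : SimpleGraph V) (W : Set V)
    (x a b : V) : Prop :=
  a ∈ nbrsIn G W x ∧ b ∈ nbrsIn G W x ∧ A.pos a < A.pos b ∧
    ∀ c ∈ nbrsIn G W x, ¬ (A.pos a < A.pos c ∧ A.pos c < A.pos b)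

/-- `e` is an edge of the profile `pr(x)`: an edge of the outer path between two
consecutive neighbours of `x`. -/
def ProfileEdge {V : Type} (A : ArcDiagram V) (G : SimpleGraph V) (W : Set V)
    (x : V) (e : Sym2 V) : Prop :=
  ∃ a b : V, e = s(a, b) ∧ ConsecNbrs A G W x a b ∧ G.Adj a b

/-! ### Construction sequences of planar 3-trees and their dual face trees -/

/-- A construction sequence of a planar 3-tree `G`: starting from the triangle on the
first three vertices, each subsequent vertex `ord j` is inserted into a face `F j`
(a triangle of three earlier vertices that was created earlier and not yet
subdivided) and joined to its three vertices. -/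
structure P3TConstruction (V : Type) [Fintype V] [DecidableEq V]
    (G : SimpleGraph V) where
  n : ℕ
  three_le : 3 ≤ n
  card_eq : Fintype.card V = n
  ord : Fin n ≃ V
  F : Fin n → Finset V
  adj_base : ∀ i j : Fin n, (i : ℕ) < 3 → (j : ℕ) < 3 → (G.Adj (ord i) (ord j) ↔ i ≠ j)
  adj_ins : ∀ j : Fin n, 3 ≤ (j : ℕ) → ∀ i : Fin n, i < j →
    (G.Adj (ord i) (ord j) ↔ ord i ∈ F j)
  F_card : ∀ j : Fin n, 3 ≤ (j : ℕ) → (F j).card = 3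
  F_sub : ∀ j : Fin n, 3 ≤ (j : ℕ) → ∀ u ∈ F j, ∃ i : Fin n, i < j ∧ ord i = u
  F_inj : ∀ j k : Fin n, 3 ≤ (j : ℕ) → 3 ≤ (k : ℕ) → F j = F k → j = k
  F_created : ∀ j : Fin n, 3 ≤ (j : ℕ) →
    F j = {ord ⟨0, Nat.lt_of_lt_of_le (by norm_num) three_le⟩,
           ord ⟨1, Nat.lt_of_lt_of_le (by norm_num) three_le⟩,
           ord ⟨2, Nat.lt_of_lt_of_le (by norm_num) three_le⟩} ∨
      ∃ i : Fin n, i < j ∧ 3 ≤ (i : ℕ) ∧ ∃ x ∈ F i, F j = insert (ord i) ((F i).erase x)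

namespace P3TConstruction

variable {V : Type} [Fintype V] [DecidableEq V] {G : SimpleGraph V}

/-- The root face `v1 v2 v3` of the dual face tree. -/
def rootFace (C : P3TConstruction V G) : Finset V :=
  {C.ord ⟨0, Nat.lt_of_lt_of_le (by norm_num) C.three_le⟩,
   C.ord ⟨1, Nat.lt_of_lt_of_le (by norm_num) C.three_le⟩,
   C.ord ⟨2, Nat.lt_of_lt_of_le (by norm_num) C.three_le⟩}

/-- The child face of `F j` obtained by replacing its vertex `x` with `ord j`. -/
def childFace (C : P3TConstruction V G) (j : Fin C.n) (x : V) : Finset V :=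
  insert (C.ord j) ((C.F j).erase x)

/-- A face is internal (has a face vertex, i.e. is subdivided at some point, i.e. is
active at some point) iff some vertex is inserted into it. -/
def IsInternalFace (C : P3TConstruction V G) (f : Finset V) : Prop :=
  ∃ j : Fin C.n, 3 ≤ (j : ℕ) ∧ C.F j = f

/-- `g` is a child of `f` in the dual face tree. -/
def IsChildOf (C : P3TConstruction V G) (g f : Finset V) : Prop :=
  ∃ j : Fin C.n, 3 ≤ (j : ℕ) ∧ C.F j = f ∧ ∃ x ∈ C.F j, g = C.childFace j x

/-- `f` is a node of the dual face tree `𝒯`. -/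
def IsFace (C : P3TConstruction V G) (f : Finset V) : Prop :=
  f = C.rootFace ∨ ∃ f' : Finset V, C.IsChildOf f f'

/-- The grand-degree of a face: the maximal number of active child faces over the
whole construction, i.e. the number of its internal (non-leaf) children in `𝒯`. -/
def gd (C : P3TConstruction V G) (f : Finset V) : ℕ :=
  {g : Finset V | C.IsChildOf g f ∧ C.IsInternalFace g}.ncard

end P3TConstruction

/-- `G` is a Kleetope over the sub-triangulation on the vertex set `S`: both `G` and
`G[S]` are plane triangulations, every vertex outside `S` has exactly the three
vertices of a triangle of `G[S]` as neighbours (so it is inserted into a face of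
`G[S]`), and the number of inserted vertices equals the number `2|S| - 4` of faces
of `G[S]` (so that exactly one vertex is inserted into each face). -/
def IsKleetopeOf {V : Type} [Fintype V] [DecidableEq V]
    (G : SimpleGraph V) (S : Finset V) : Prop :=
  IsTriangulation G ∧ IsTriangulation (G.induce (S : Set V)) ∧
    (∀ v : V, v ∉ S →
      (G.neighborSet v).ncard = 3 ∧ G.neighborSet v ⊆ (S : Set V) ∧
        ∀ a ∈ G.neighborSet v, ∀ b ∈ G.neighborSet v, a ≠ b → G.Adj a b) ∧
    Fintype.card V + 4 = 3 * S.card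

end

/-! ### Gap states and insertion moves -/

/-- The shape of an active triangular face around its gap on the spine; `dead` marks a face that
is never subdivided. -/
inductive GapShape : Type
  | tentLeft | tentRight | zigzag | tightTent | tightPocket | dead
deriving DecidableEq

namespace GapShape

/-- The number of corners left of the gap. -/
def left : GapShape → ℕ
  | tentRight => 1
  | _ => 2

/-- Which corners (from left to right) see the gap from above. -/
def up : GapShape → Fin 3 → Bool
  | tentLeft => ![true, true, true]
  | tentRight => ![true, true, true]
  | zigzag => ![false, true, true]
  | tightTent => ![true, true, true]
  | tightPocket => ![false, false, true]
  | dead => ![false, false, false]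

/-- Which corners (from left to right) see the gap from below. -/
def down : GapShape → Fin 3 → Bool
  | tentLeft => ![false, true, true]
  | tentRight => ![true, true, false]
  | zigzag => ![true, true, false]
  | tightTent => ![false, true, false]
  | tightPocket => ![true, true, false]
  | dead => ![false, false, false]

/-- The critical corner of a tight gap. -/
def crit : GapShape → Option (Fin 3)
  | tightTent => some 1
  | tightPocket => some 2
  | _ => none

end GapShape

/-- A gap shape, possibly rotated by a half turn. -/
structure GapState : Type where
  shape : GapShape
  rotated : Bool
deriving DecidableEq

namespace GapState

def left (s : GapState) : ℕ := if s.rotated then 3 - s.shape.left else s.shape.left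

def up (s : GapState) (j : Fin 3) : Bool :=
  if s.rotated then s.shape.down j.rev else s.shape.up j

def down (s : GapState) (j : Fin 3) : Bool :=
  if s.rotated then s.shape.up j.rev else s.shape.down j

def crit (s : GapState) : Option (Fin 3) :=
  if s.rotated then s.shape.crit.map Fin.rev else s.shape.crit

/-- An integer slot for each corner; the gap has slot `0` and slots of absolute value less than
ten are close to the gap. -/
def slot (s : GapState) (j : Fin 3) : ℤ :=
  if (j : ℕ) < s.left then 10 * ((j : ℤ) - s.left) else 10 * ((j : ℤ) - s.left + 1)

end GapState

def ArcKind.flip : ArcKind → ArcKind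
  | .mountain => .pocket
  | .pocket => .mountain
  | .biarc => .biarc

/-- How to draw a new vertex at slot `0` of a gap: the kind of the edge to every corner, the slot
where it crosses the spine if it is a biarc, and for every corner `i` the slot and the state of
the gap of the face obtained by replacing corner `i`, together with the order of its corners
(where `i` now stands for the new vertex). -/
structure GapMove : Type where
  kind : Fin 3 → ArcKind
  cross : Fin 3 → ℤ
  gap : Fin 3 → ℤ
  next : Fin 3 → GapState
  perm : Fin 3 → Fin 3 → Fin 3

namespace GapMove

/-- The move seen after a half turn. -/
def rotate (m : GapMove) : GapMove where
  kind i := (m.kind i.rev).flip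
  cross i := - m.cross i.rev
  gap i := - m.gap i.rev
  next i := ⟨(m.next i.rev).shape, !(m.next i.rev).rotated⟩
  perm i j := (m.perm i.rev j.rev).rev

/-- The number of biarcs drawn by a move. -/
def cost (m : GapMove) : ℕ :=
  (if m.kind 0 = .biarc then 1 else 0) + (if m.kind 1 = .biarc then 1 else 0) +
    (if m.kind 2 = .biarc then 1 else 0)

/-- The slot of the `j`-th corner of the face replacing corner `i`. -/
def childSlot (m : GapMove) (s : GapState) (i j : Fin 3) : ℤ :=
  if m.perm i j = i then 0 else s.slot (m.perm i j)

/-- The arcs above the spine after the move, including those to the new gaps. -/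
def upper (m : GapMove) (s : GapState) : List (ℤ × ℤ) :=
  (List.finRange 3).flatMap (fun i =>
    match m.kind i with
    | .mountain => [(min (s.slot i) 0, max (s.slot i) 0)]
    | .pocket => []
    | .biarc => [(m.cross i, max (s.slot i) 0)]) ++
  (List.finRange 3).flatMap (fun i => (List.finRange 3).flatMap fun j =>
    if (m.next i).up j then
      [(min (m.childSlot s i j) (m.gap i), max (m.childSlot s i j) (m.gap i))] else [])

/-- The arcs below the spine after the move, including those to the new gaps. -/
def lower (m : GapMove) (s : GapState) : List (ℤ × ℤ) :=
  (List.finRange 3).flatMap (fun i =>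
    match m.kind i with
    | .mountain => []
    | .pocket => [(min (s.slot i) 0, max (s.slot i) 0)]
    | .biarc => [(min (s.slot i) 0, m.cross i)]) ++
  (List.finRange 3).flatMap (fun i => (List.finRange 3).flatMap fun j =>
    if (m.next i).down j then
      [(min (m.childSlot s i j) (m.gap i), max (m.childSlot s i j) (m.gap i))] else [])

/-- A slot close to the gap. -/
def Near (a : ℤ) : Prop := -10 < a ∧ a < 10

instance (a : ℤ) : Decidable (Near a) := inferInstanceAs (Decidable (_ ∧ _))

/-- A family of arcs between slots is pairwise non-crossing, and leaves the gap only towards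
corners that see it. -/
def ArcsFit (s : GapState) (see : Fin 3 → Bool) (l : List (ℤ × ℤ)) : Prop :=
  (∀ p ∈ l, ∀ q ∈ l, ¬ (p.1 < q.1 ∧ q.1 < p.2 ∧ p.2 < q.2)) ∧
  ∀ p ∈ l, p.1 < p.2 ∧ ((Near p.1 ∧ Near p.2) ∨
    (Near p.1 ∧ ∃ j, see j = true ∧ p.2 = s.slot j) ∨
    (Near p.2 ∧ ∃ j, see j = true ∧ p.1 = s.slot j))

instance (s : GapState) (see : Fin 3 → Bool) (l : List (ℤ × ℤ)) : Decidable (ArcsFit s see l) :=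
  inferInstanceAs (Decidable (_ ∧ _))

/-- The position of a gap relative to the ordered corners. -/
def Placed {α : Type} [LT α] (s : GapState) (c : Fin 3 → α) (h : α) : Prop :=
  (c 0 < c 1 ∧ c 1 < c 2) ∧ ∀ j : Fin 3, if (j : ℕ) < s.left then c j < h else h < c j

instance (s : GapState) (c : Fin 3 → ℤ) (h : ℤ) : Decidable (Placed s c h) :=
  inferInstanceAs (Decidable (_ ∧ _))

/-- A move is a legal way to insert a vertex into a gap of the given state. -/
def Legal (m : GapMove) (s : GapState) : Prop :=
  (∀ i, Near (m.gap i) ∧ m.gap i ≠ 0 ∧ Function.Injective (m.perm i) ∧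
    ((m.next i).shape ≠ .dead → Placed (m.next i) (m.childSlot s i) (m.gap i))) ∧
  (∀ i j, i ≠ j → m.gap i ≠ m.gap j) ∧
  (∀ i, m.kind i = .biarc → Near (m.cross i) ∧ m.cross i ≠ 0 ∧
    min (s.slot i) 0 < m.cross i ∧ m.cross i < max (s.slot i) 0 ∧ ∀ j, m.cross i ≠ m.gap j) ∧
  (∀ i j, i ≠ j → m.kind i = .biarc → m.kind j = .biarc → m.cross i ≠ m.cross j) ∧
  ArcsFit s s.up (m.upper s) ∧ ArcsFit s s.down (m.lower s)

instance (m : GapMove) (s : GapState) : Decidable (Legal m s) :=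
  inferInstanceAs (Decidable (_ ∧ _))

end GapMove

namespace GapShape

open ArcKind

/-- The moves used for the unrotated shapes. -/
def moves : GapShape → List GapMove
  | tentLeft =>
    [⟨![mountain, pocket, pocket], ![0, 0, 0], ![2, 1, -1],
        ![⟨dead, false⟩, ⟨tentLeft, false⟩, ⟨tentLeft, false⟩], ![id, id, id]⟩,
      ⟨![mountain, mountain, pocket], ![0, 0, 0], ![-1, 1, 2],
        ![⟨tentLeft, true⟩, ⟨tentLeft, false⟩, ⟨dead, false⟩], ![![1, 0, 2], id, id]⟩,
      ⟨![mountain, pocket, mountain], ![0, 0, 0], ![1, 2, -1],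
        ![⟨tentRight, true⟩, ⟨dead, false⟩, ⟨tentLeft, false⟩], ![![1, 0, 2], id, id]⟩,
      ⟨![mountain, pocket, biarc], ![0, 0, 2], ![3, 1, -1],
        ![⟨tightPocket, false⟩, ⟨tightTent, false⟩, ⟨tentLeft, false⟩], ![![1, 0, 2], id, id]⟩,
      ⟨![mountain, biarc, pocket], ![0, -2, 0], ![-1, 1, -3],
        ![⟨tightTent, true⟩, ⟨tentLeft, false⟩, ⟨tightTent, false⟩], ![![1, 0, 2], id, id]⟩]
  | tentRight =>
    [⟨![pocket, pocket, mountain], ![0, 0, 0], ![1, -1, 2],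
        ![⟨tentRight, false⟩, ⟨tentRight, false⟩, ⟨dead, false⟩], ![id, id, id]⟩,
      ⟨![mountain, pocket, mountain], ![0, 0, 0], ![1, 2, -1],
        ![⟨tentRight, false⟩, ⟨dead, false⟩, ⟨tentLeft, true⟩], ![id, id, ![0, 2, 1]]⟩,
      ⟨![pocket, mountain, mountain], ![0, 0, 0], ![2, -1, 1],
        ![⟨dead, false⟩, ⟨tentRight, false⟩, ⟨tentRight, true⟩], ![id, id, ![0, 2, 1]]⟩,
      ⟨![pocket, biarc, mountain], ![0, 2, 0], ![1, -1, 3],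
        ![⟨tightPocket, true⟩, ⟨tentRight, false⟩, ⟨tightPocket, false⟩], ![id, id, ![0, 2, 1]]⟩,
      ⟨![biarc, pocket, mountain], ![-2, 0, 0], ![1, -3, -1],
        ![⟨tentRight, false⟩, ⟨tightPocket, true⟩, ⟨tightTent, true⟩], ![id, id, ![0, 2, 1]]⟩]
  | zigzag =>
    [⟨![pocket, mountain, mountain], ![0, 0, 0], ![2, 1, -1],
        ![⟨dead, false⟩, ⟨zigzag, false⟩, ⟨tentRight, true⟩], ![id, id, id]⟩,
      ⟨![pocket, pocket, mountain], ![0, 0, 0], ![-1, 1, 2],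
        ![⟨tentRight, false⟩, ⟨zigzag, false⟩, ⟨dead, false⟩], ![![1, 0, 2], id, id]⟩,
      ⟨![pocket, biarc, mountain], ![0, -2, 0], ![-3, 1, -1],
        ![⟨tightPocket, true⟩, ⟨zigzag, false⟩, ⟨tightPocket, false⟩], ![![1, 0, 2], id, id]⟩,
      ⟨![pocket, mountain, biarc], ![0, 0, 2], ![1, 3, -1],
        ![⟨tightTent, false⟩, ⟨tightPocket, false⟩, ⟨tentRight, true⟩], ![![1, 0, 2], id, id]⟩]
  | tightTent =>
    [⟨![mountain, pocket, mountain], ![0, 0, 0], ![1, 2, -1],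
        ![⟨zigzag, false⟩, ⟨dead, false⟩, ⟨tentLeft, false⟩], ![![1, 0, 2], id, id]⟩,
      ⟨![mountain, pocket, biarc], ![0, 0, 2], ![3, 1, -1],
        ![⟨tightPocket, false⟩, ⟨tightTent, false⟩, ⟨tentLeft, false⟩], ![![1, 0, 2], id, id]⟩]
  | tightPocket =>
    [⟨![pocket, pocket, mountain], ![0, 0, 0], ![-1, 1, 2],
        ![⟨zigzag, true⟩, ⟨zigzag, false⟩, ⟨dead, false⟩], ![![1, 0, 2], id, id]⟩,
      ⟨![pocket, biarc, mountain], ![0, -2, 0], ![-3, 1, -1],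
        ![⟨tightPocket, true⟩, ⟨zigzag, false⟩, ⟨tightPocket, false⟩], ![![1, 0, 2], id, id]⟩]
  | dead => []

end GapShape

/-- The moves used for a gap state. -/
def GapState.moves (s : GapState) : List GapMove :=
  if s.rotated then s.shape.moves.map GapMove.rotate else s.shape.moves

theorem GapState.legal_of_mem_moves (s : GapState) : ∀ m ∈ s.moves, m.Legal s := by
  obtain ⟨sh, r⟩ := s
  cases sh <;> cases r <;> decide +kernel

/-! ### Face trees and their biarc budgets -/

/-- The tree of successive subdivisions of a triangular face with corners labelled by `Fin 3`:
`node x t` inserts the vertex `x`, and `t i` subdivides the face in which `x` replaces the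
corner `i`. -/
inductive FaceTree (V : Type) : Type
  | leaf : FaceTree V
  | node (x : V) (t : Fin 3 → FaceTree V) : FaceTree V

namespace FaceTree

variable {V : Type}

/-- The number of inserted vertices. -/
def size : FaceTree V → ℕ
  | leaf => 0
  | node _ t => 1 + ((t 0).size + (t 1).size + (t 2).size)

/-- Budget recursion for a tight gap with critical corner `i` and other corners `j`, `k`, where
`g` and `b` are the budgets of the subtrees and `z` tells which of them are empty. -/
def tightStep (z : Fin 3 → Prop) [DecidablePred z] (g : Fin 3 → ℕ) (b : Fin 3 → Fin 3 → ℕ)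
    (i j k : Fin 3) : ℕ :=
  if z i then g j + g k
  else 1 + b i i + max (b j k + g k) (g j + b k j)

/-- Budget recursion for a `tentLeft` or `tentRight` gap. -/
def tentStep (z : Fin 3 → Prop) [DecidablePred z] (g : Fin 3 → ℕ) (b : Fin 3 → Fin 3 → ℕ)
    (r p q : Fin 3) : ℕ :=
  if z r ∨ z p ∨ z q then g r + g p + g q
  else 1 + min (g q + b p p + b r q) (b q p + g p + b r r)

/-- Budget recursion for a `zigzag` gap. -/
def zigzagStep (z : Fin 3 → Prop) [DecidablePred z] (g : Fin 3 → ℕ) (b : Fin 3 → Fin 3 → ℕ)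
    (p q r : Fin 3) : ℕ :=
  if z p ∨ z r then g p + g q + g r
  else 1 + min (b r r + b p q + g q) (g r + b p p + b q r)

/-- The budget of a gap without critical corner. -/
def looseStep (z : Fin 3 → Prop) [DecidablePred z] (g : Fin 3 → ℕ) (b : Fin 3 → Fin 3 → ℕ) : ℕ :=
  (Finset.univ.filter fun f : Fin 3 → Fin 3 => Function.Injective f).sup fun f =>
    max (tentStep z g b (f 0) (f 1) (f 2)) (zigzagStep z g b (f 0) (f 1) (f 2))

/-- The budgets of a tree in a gap: without critical corner, and for each critical corner. -/
def budget : FaceTree V → ℕ × (Fin 3 → ℕ)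
  | leaf => (0, fun _ => 0)
  | node _ t =>
    (looseStep (fun i => (t i).size = 0) (fun i => (t i).budget.1) (fun i => (t i).budget.2),
      fun i => tightStep (fun i => (t i).size = 0) (fun i => (t i).budget.1)
        (fun i => (t i).budget.2) i (i + 1) (i + 2))

/-- The budget of a tree in a gap of the given state whose `j`-th corner has label `f j`. -/
def stateBudget (t : FaceTree V) (s : GapState) (f : Fin 3 → Fin 3) : ℕ :=
  match s.crit with
  | none => t.budget.1
  | some j => t.budget.2 (f j)

theorem tightStep_comm (z : Fin 3 → Prop) [DecidablePred z] (g : Fin 3 → ℕ)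
    (b : Fin 3 → Fin 3 → ℕ) (i j k : Fin 3) : tightStep z g b i j k = tightStep z g b i k j := by
  unfold tightStep
  split_ifs <;> omega

theorem tightStep_eq (z : Fin 3 → Prop) [DecidablePred z] (g : Fin 3 → ℕ)
    (b : Fin 3 → Fin 3 → ℕ) {i j k : Fin 3} (hij : i ≠ j) (hik : i ≠ k) (hjk : j ≠ k) :
    tightStep z g b i (i + 1) (i + 2) = tightStep z g b i j k := by
  have h : (j = i + 1 ∧ k = i + 2) ∨ (j = i + 2 ∧ k = i + 1) := by
    revert i j k; decide
  rcases h with ⟨rfl, rfl⟩ | ⟨rfl, rfl⟩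
  · rfl
  · exact tightStep_comm ..

/-- The inequalities between budgets and size. -/
structure Fair (N g : ℕ) (b : Fin 3 → ℕ) : Prop where
  loose : 4 * g + 3 ≤ 3 * N
  mixed : ∀ i, 2 * (g + b i) + 3 ≤ 3 * N
  tight : ∀ i j, i ≠ j → 2 * (b i + b j) + 3 ≤ 3 * N

section
variable {z : Fin 3 → Prop} [DecidablePred z] {N g : Fin 3 → ℕ} {b : Fin 3 → Fin 3 → ℕ}
  {r p q : Fin 3}

/-- Budgets are zero for an empty tree, and fair otherwise. -/
def Balanced (z : Prop) (N g : ℕ) (b : Fin 3 → ℕ) : Prop :=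
  (z ∧ N = 0 ∧ g = 0 ∧ ∀ i, b i = 0) ∨ (¬ z ∧ Fair N g b)

theorem Balanced.cases {z : Prop} {N g : ℕ} {b : Fin 3 → ℕ} (h : Balanced z N g b)
    {r p q : Fin 3} (hrp : r ≠ p) (hrq : r ≠ q) (hpq : p ≠ q) :
    (z ∧ N = 0 ∧ g = 0 ∧ b r = 0 ∧ b p = 0 ∧ b q = 0) ∨
    (¬ z ∧ 4 * g + 3 ≤ 3 * N ∧ 2 * (g + b r) + 3 ≤ 3 * N ∧ 2 * (g + b p) + 3 ≤ 3 * N ∧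
      2 * (g + b q) + 3 ≤ 3 * N ∧ 2 * (b r + b p) + 3 ≤ 3 * N ∧ 2 * (b r + b q) + 3 ≤ 3 * N ∧
      2 * (b p + b q) + 3 ≤ 3 * N) := by
  rcases h with ⟨hz, hN, hg, hb⟩ | ⟨hz, h⟩
  · exact .inl ⟨hz, hN, hg, hb _, hb _, hb _⟩
  · exact .inr ⟨hz, h.loose, h.mixed _, h.mixed _, h.mixed _, h.tight _ _ hrp, h.tight _ _ hrq,
      h.tight _ _ hpq⟩

theorem four_mul_tentStep_le (H : ∀ i, Balanced (z i) (N i) (g i) (b i))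
    (hrp : r ≠ p) (hrq : r ≠ q) (hpq : p ≠ q) :
    4 * tentStep z g b r p q ≤ 3 * (N r + N p + N q) := by
  unfold tentStep
  rcases (H r).cases hrp hrq hpq with hr | hr <;> rcases (H p).cases hrp hrq hpq with hp | hp <;>
    rcases (H q).cases hrp hrq hpq with hq | hq <;>
    simp only [hr.1, hp.1, hq.1, true_or, or_true, or_self, if_true, if_false] <;> omega

theorem four_mul_zigzagStep_le (H : ∀ i, Balanced (z i) (N i) (g i) (b i))
    (hrp : r ≠ p) (hrq : r ≠ q) (hpq : p ≠ q) :
    4 * zigzagStep z g b r p q ≤ 3 * (N r + N p + N q) := by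
  unfold zigzagStep
  rcases (H r).cases hrp hrq hpq with hr | hr <;> rcases (H p).cases hrp hrq hpq with hp | hp <;>
    rcases (H q).cases hrp hrq hpq with hq | hq <;>
    simp only [hr.1, hq.1, true_or, or_true, or_self, if_true, if_false] <;> omega

theorem tightStep_add_tightStep_le (H : ∀ i, Balanced (z i) (N i) (g i) (b i))
    (hrp : r ≠ p) (hrq : r ≠ q) (hpq : p ≠ q) :
    2 * (tightStep z g b r p q + tightStep z g b p r q) ≤ 3 * (N r + N p + N q) := by
  unfold tightStep
  rcases (H r).cases hrp hrq hpq with hr | hr <;> rcases (H p).cases hrp hrq hpq with hp | hp <;>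
    rcases (H q).cases hrp hrq hpq with hq | hq <;>
    simp only [hr.1, hp.1, if_true, if_false] <;> omega

theorem tentStep_add_tightStep_le (H : ∀ i, Balanced (z i) (N i) (g i) (b i))
    (hrp : r ≠ p) (hrq : r ≠ q) (hpq : p ≠ q) :
    2 * (tentStep z g b r p q + tightStep z g b r p q) ≤ 3 * (N r + N p + N q) ∧
    2 * (tentStep z g b r p q + tightStep z g b p r q) ≤ 3 * (N r + N p + N q) ∧
    2 * (tentStep z g b r p q + tightStep z g b q r p) ≤ 3 * (N r + N p + N q) := by
  unfold tentStep tightStep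
  rcases (H r).cases hrp hrq hpq with hr | hr <;> rcases (H p).cases hrp hrq hpq with hp | hp <;>
    rcases (H q).cases hrp hrq hpq with hq | hq <;>
    simp only [hr.1, hp.1, hq.1, true_or, or_true, or_self, if_true, if_false] <;>
    refine ⟨?_, ?_, ?_⟩ <;> omega

theorem zigzagStep_add_tightStep_le (H : ∀ i, Balanced (z i) (N i) (g i) (b i))
    (hrp : r ≠ p) (hrq : r ≠ q) (hpq : p ≠ q) :
    2 * (zigzagStep z g b r p q + tightStep z g b r p q) ≤ 3 * (N r + N p + N q) ∧
    2 * (zigzagStep z g b r p q + tightStep z g b p r q) ≤ 3 * (N r + N p + N q) ∧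
    2 * (zigzagStep z g b r p q + tightStep z g b q r p) ≤ 3 * (N r + N p + N q) := by
  unfold zigzagStep tightStep
  rcases (H r).cases hrp hrq hpq with hr | hr <;> rcases (H p).cases hrp hrq hpq with hp | hp <;>
    rcases (H q).cases hrp hrq hpq with hq | hq <;>
    simp only [hr.1, hp.1, hq.1, true_or, or_true, or_self, if_true, if_false] <;>
    refine ⟨?_, ?_, ?_⟩ <;> omega

end

theorem fair_step {z : Fin 3 → Prop} [DecidablePred z] {N g : Fin 3 → ℕ} {b : Fin 3 → Fin 3 → ℕ}
    (H : ∀ i, Balanced (z i) (N i) (g i) (b i)) :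
    Fair (1 + (N 0 + N 1 + N 2)) (looseStep z g b)
      (fun i => tightStep z g b i (i + 1) (i + 2)) := by
  have hN : ∀ r p q : Fin 3, r ≠ p → r ≠ q → p ≠ q → N r + N p + N q = N 0 + N 1 + N 2 := by
    intro r p q
    fin_cases r <;> fin_cases p <;> fin_cases q <;> simp <;> omega
  have hloose : ∀ B : ℕ, (∀ r p q : Fin 3, r ≠ p → r ≠ q → p ≠ q →
      tentStep z g b r p q ≤ B ∧ zigzagStep z g b r p q ≤ B) → looseStep z g b ≤ B := by
    intro B hB
    refine Finset.sup_le fun f hf => ?_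
    have hf' := (Finset.mem_filter.1 hf).2
    have := hB (f 0) (f 1) (f 2) (hf'.ne (by decide)) (hf'.ne (by decide)) (hf'.ne (by decide))
    exact max_le this.1 this.2
  refine ⟨?_, fun i => ?_, fun i j hij => ?_⟩
  · have := hloose (3 * (N 0 + N 1 + N 2) / 4) fun r p q h1 h2 h3 => by
      have := hN r p q h1 h2 h3
      have := four_mul_tentStep_le H h1 h2 h3
      have := four_mul_zigzagStep_le H h1 h2 h3
      omega
    omega
  · have key : ∀ r p q : Fin 3, r ≠ p → r ≠ q → p ≠ q →
        2 * (tentStep z g b r p q + tightStep z g b i (i + 1) (i + 2)) ≤ 3 * (N 0 + N 1 + N 2) ∧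
        2 * (zigzagStep z g b r p q + tightStep z g b i (i + 1) (i + 2)) ≤
          3 * (N 0 + N 1 + N 2) := by
      intro r p q h1 h2 h3
      rw [← hN r p q h1 h2 h3]
      have ht := tentStep_add_tightStep_le H h1 h2 h3
      have hz := zigzagStep_add_tightStep_le H h1 h2 h3
      have hi : i = r ∨ i = p ∨ i = q := by
        clear ht hz
        revert i r p q; decide
      rcases hi with rfl | rfl | rfl
      · rw [tightStep_eq z g b h1 h2 h3]; exact ⟨ht.1, hz.1⟩
      · rw [tightStep_eq z g b h1.symm h3 h2]; exact ⟨ht.2.1, hz.2.1⟩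
      · rw [tightStep_eq z g b h2.symm h3.symm h1]; exact ⟨ht.2.2, hz.2.2⟩
    have h0 := key 0 1 2 (by decide) (by decide) (by decide)
    have := hloose (3 * (N 0 + N 1 + N 2) / 2 - tightStep z g b i (i + 1) (i + 2))
      fun r p q h1 h2 h3 => by
        have := key r p q h1 h2 h3
        omega
    omega
  · obtain ⟨k, hik, hjk⟩ : ∃ k, i ≠ k ∧ j ≠ k := by revert i j; decide
    rw [tightStep_eq z g b hij hik hjk, tightStep_eq z g b hij.symm hjk hik]
    have := tightStep_add_tightStep_le H hij hik hjk
    have := hN i j k hij hik hjk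
    omega

theorem budget_balanced : ∀ t : FaceTree V, Balanced (t.size = 0) t.size t.budget.1 t.budget.2
  | leaf => .inl ⟨rfl, rfl, rfl, fun _ => rfl⟩
  | node _ t => .inr ⟨by simp [size], fair_step fun i => (t i).budget_balanced⟩

theorem budget_le (t : FaceTree V) : t.budget.1 ≤ 3 * t.size / 4 := by
  rcases t.budget_balanced with h | h
  · omega
  · have := h.2.loose
    omega

end FaceTree

namespace FaceTree

variable {V : Type}

theorem tentStep_le_budget (x : V) (t : Fin 3 → FaceTree V) {f : Fin 3 → Fin 3}
    (hf : Function.Injective f) {r p q : Fin 3} (hrp : r ≠ p) (hrq : r ≠ q) (hpq : p ≠ q) :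
    tentStep (fun i => (t i).size = 0) (fun i => (t i).budget.1) (fun i => (t i).budget.2)
      (f r) (f p) (f q) ≤ (node x t).budget.1 := by
  have hinj : Function.Injective (f ∘ ![r, p, q]) := hf.comp (by
    revert r p q; decide)
  exact (le_max_left _ _).trans (Finset.le_sup (f := fun f : Fin 3 → Fin 3 =>
    max (tentStep (fun i => (t i).size = 0) (fun i => (t i).budget.1)
      (fun i => (t i).budget.2) (f 0) (f 1) (f 2))
      (zigzagStep (fun i => (t i).size = 0) (fun i => (t i).budget.1)
      (fun i => (t i).budget.2) (f 0) (f 1) (f 2)))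
    (Finset.mem_filter.2 ⟨Finset.mem_univ (f ∘ ![r, p, q]), hinj⟩))

theorem zigzagStep_le_budget (x : V) (t : Fin 3 → FaceTree V) {f : Fin 3 → Fin 3}
    (hf : Function.Injective f) {r p q : Fin 3} (hrp : r ≠ p) (hrq : r ≠ q) (hpq : p ≠ q) :
    zigzagStep (fun i => (t i).size = 0) (fun i => (t i).budget.1) (fun i => (t i).budget.2)
      (f r) (f p) (f q) ≤ (node x t).budget.1 := by
  have hinj : Function.Injective (f ∘ ![r, p, q]) := hf.comp (by
    revert r p q; decide)
  exact (le_max_right _ _).trans (Finset.le_sup (f := fun f : Fin 3 → Fin 3 =>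
    max (tentStep (fun i => (t i).size = 0) (fun i => (t i).budget.1)
      (fun i => (t i).budget.2) (f 0) (f 1) (f 2))
      (zigzagStep (fun i => (t i).size = 0) (fun i => (t i).budget.1)
      (fun i => (t i).budget.2) (f 0) (f 1) (f 2)))
    (Finset.mem_filter.2 ⟨Finset.mem_univ (f ∘ ![r, p, q]), hinj⟩))

theorem tightStep_eq_budget (x : V) (t : Fin 3 → FaceTree V) {f : Fin 3 → Fin 3}
    (hf : Function.Injective f) {i j k : Fin 3} (hij : i ≠ j) (hik : i ≠ k) (hjk : j ≠ k) :
    tightStep (fun i => (t i).size = 0) (fun i => (t i).budget.1) (fun i => (t i).budget.2)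
      (f i) (f j) (f k) = (node x t).budget.2 (f i) :=
  (tightStep_eq _ _ _ (hf.ne hij) (hf.ne hik) (hf.ne hjk)).symm

theorem budget_eq_zero {t : FaceTree V} (h : t.size = 0) : t.budget.1 = 0 := by
  cases t with
  | leaf => rfl
  | node => simp [size] at h

/-- A move serves a tree in a gap whose `j`-th corner has label `f j` within budget `B`. -/
def Affordable (t : Fin 3 → FaceTree V) (f : Fin 3 → Fin 3) (B : ℕ) (m : GapMove) : Prop :=
  (∀ i, (m.next i).shape = .dead → (t (f i)).size = 0) ∧
    m.cost + ((t (f 0)).stateBudget (m.next 0) (f ∘ m.perm 0) +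
      (t (f 1)).stateBudget (m.next 1) (f ∘ m.perm 1) +
      (t (f 2)).stateBudget (m.next 2) (f ∘ m.perm 2)) ≤ B

theorem exists_affordable_move_of_not_rotated (x : V) (t : Fin 3 → FaceTree V) {f : Fin 3 → Fin 3}
    (hf : Function.Injective f) (s : GapShape) (hs : s ≠ .dead) :
    ∃ m ∈ s.moves, Affordable t f ((node x t).stateBudget ⟨s, false⟩ f) m := by
  cases s with
  | dead => exact absurd rfl hs
  | tentLeft =>
    have h := tentStep_le_budget x t hf (r := 0) (p := 1) (q := 2)
      (by decide) (by decide) (by decide)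
    simp only [GapShape.moves, List.exists_mem_cons_iff, List.not_mem_nil, false_and, exists_false,
      or_false]
    by_cases h0 : (t (f 0)).size = 0 <;> by_cases h1 : (t (f 1)).size = 0 <;>
      by_cases h2 : (t (f 2)).size = 0 <;>
      simp [tentStep, h0, h1, h2, Affordable, Fin.forall_fin_succ, GapMove.cost, stateBudget,
        GapState.crit, GapShape.crit, budget_eq_zero] at h ⊢ <;> omega
  | tentRight =>
    have h := tentStep_le_budget x t hf (r := 2) (p := 0) (q := 1)
      (by decide) (by decide) (by decide)
    simp only [GapShape.moves, List.exists_mem_cons_iff, List.not_mem_nil, false_and, exists_false,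
      or_false]
    by_cases h0 : (t (f 0)).size = 0 <;> by_cases h1 : (t (f 1)).size = 0 <;>
      by_cases h2 : (t (f 2)).size = 0 <;>
      simp [tentStep, h0, h1, h2, Affordable, Fin.forall_fin_succ, GapMove.cost, stateBudget,
        GapState.crit, GapShape.crit, budget_eq_zero] at h ⊢ <;> omega
  | zigzag =>
    have h := zigzagStep_le_budget x t hf (r := 0) (p := 1) (q := 2)
      (by decide) (by decide) (by decide)
    simp only [GapShape.moves, List.exists_mem_cons_iff, List.not_mem_nil, false_and, exists_false,
      or_false]
    by_cases h0 : (t (f 0)).size = 0 <;> by_cases h1 : (t (f 1)).size = 0 <;>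
      by_cases h2 : (t (f 2)).size = 0 <;>
      simp [zigzagStep, h0, h1, h2, Affordable, Fin.forall_fin_succ, GapMove.cost, stateBudget,
        GapState.crit, GapShape.crit, budget_eq_zero] at h ⊢ <;> omega
  | tightTent =>
    have h := tightStep_eq_budget x t hf (i := 1) (j := 0) (k := 2)
      (by decide) (by decide) (by decide)
    simp only [GapShape.moves, List.exists_mem_cons_iff, List.not_mem_nil, false_and, exists_false,
      or_false]
    by_cases h0 : (t (f 0)).size = 0 <;> by_cases h1 : (t (f 1)).size = 0 <;>
      by_cases h2 : (t (f 2)).size = 0 <;>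
      simp [tightStep, h0, h1, h2, Affordable, Fin.forall_fin_succ, GapMove.cost, stateBudget,
        GapState.crit, GapShape.crit, budget_eq_zero] at h ⊢ <;> omega
  | tightPocket =>
    have h := tightStep_eq_budget x t hf (i := 2) (j := 0) (k := 1)
      (by decide) (by decide) (by decide)
    simp only [GapShape.moves, List.exists_mem_cons_iff, List.not_mem_nil, false_and, exists_false,
      or_false]
    by_cases h0 : (t (f 0)).size = 0 <;> by_cases h1 : (t (f 1)).size = 0 <;>
      by_cases h2 : (t (f 2)).size = 0 <;>
      simp [tightStep, h0, h1, h2, Affordable, Fin.forall_fin_succ, GapMove.cost, stateBudget,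
        GapState.crit, GapShape.crit, budget_eq_zero] at h ⊢ <;> omega

theorem exists_affordable_move (x : V) (t : Fin 3 → FaceTree V) {f : Fin 3 → Fin 3}
    (hf : Function.Injective f) (s : GapState) (hs : s.shape ≠ .dead) :
    ∃ m ∈ s.moves, Affordable t f ((node x t).stateBudget s f) m := by
  obtain ⟨s, _ | _⟩ := s
  · exact exists_affordable_move_of_not_rotated x t hf s hs
  · have hr : ∀ (u : FaceTree V) (s : GapState) (f' : Fin 3 → Fin 3),
        u.stateBudget ⟨s.shape, !s.rotated⟩ f' = u.stateBudget s (f' ∘ Fin.rev) := by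
      rintro u ⟨s, _ | _⟩ f' <;> cases s <;> rfl
    obtain ⟨m, hm, h1, h2⟩ := exists_affordable_move_of_not_rotated x t
      (hf.comp Fin.rev_injective) s hs
    refine ⟨m.rotate, List.mem_map_of_mem hm, fun i hi => ?_, ?_⟩
    · simpa using h1 i.rev hi
    · rw [← hr] at h2
      refine le_trans ?_ h2
      have hc : m.rotate.cost = m.cost := by
        have hflip : ∀ k : ArcKind, k.flip = .biarc ↔ k = .biarc := by
          intro k; cases k <;> simp [ArcKind.flip]
        simp only [GapMove.cost, GapMove.rotate, hflip]
        change (if m.kind 2 = _ then 1 else 0) + (if m.kind 1 = _ then 1 else 0) +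
          (if m.kind 0 = _ then 1 else 0) = _
        ring
      have hb : ∀ i : Fin 3, (t (f i)).stateBudget (m.rotate.next i) (f ∘ m.rotate.perm i) =
          (t (f i.rev.rev)).stateBudget (m.next i.rev) ((f ∘ Fin.rev) ∘ m.perm i.rev) := by
        intro i
        rw [Fin.rev_rev]
        refine (hr _ _ _).trans ?_
        congr 1
        funext j
        simp [GapMove.rotate]
      rw [hc, hb 0, hb 1, hb 2]
      change m.cost + ((t (f 0)).stateBudget (m.next 2) ((f ∘ Fin.rev) ∘ m.perm 2) +
        (t (f 1)).stateBudget (m.next 1) ((f ∘ Fin.rev) ∘ m.perm 1) +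
        (t (f 2)).stateBudget (m.next 0) ((f ∘ Fin.rev) ∘ m.perm 0)) ≤
        m.cost + ((t (f 2)).stateBudget (m.next 0) ((f ∘ Fin.rev) ∘ m.perm 0) +
        (t (f 1)).stateBudget (m.next 1) ((f ∘ Fin.rev) ∘ m.perm 1) +
        (t (f 0)).stateBudget (m.next 2) ((f ∘ Fin.rev) ∘ m.perm 2))
      omega

end FaceTree

/-! ### Blowing up a gap -/

/-- No two intervals of the family interleave. -/
def NonCrossing (K : Set (ℝ × ℝ)) : Prop := ∀ p ∈ K, ∀ q ∈ K, ¬ Interleaved p q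

theorem NonCrossing.mono {K L : Set (ℝ × ℝ)} (h : NonCrossing L) (hKL : K ⊆ L) : NonCrossing K :=
  fun p hp q hq => h p (hKL hp) q (hKL hq)

/-- The arcs from a gap at `h` to the corners that see it. -/
def sightArcs (see : Fin 3 → Bool) (c : Fin 3 → ℝ) (h : ℝ) : Set (ℝ × ℝ) :=
  {p | ∃ j, see j = true ∧ p = (min (c j) h, max (c j) h)}

namespace GapState

theorem left_eq (s : GapState) : s.left = 1 ∨ s.left = 2 := by
  obtain ⟨s, _ | _⟩ := s <;> cases s <;> simp [left, GapShape.left]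

/-- The point of the spine at a slot, for a gap at `h` whose corners are at `c`. -/
noncomputable def point (s : GapState) (c : Fin 3 → ℝ) (h ε : ℝ) (a : ℤ) : ℝ :=
  if a = s.slot 0 then c 0 else if a = s.slot 1 then c 1 else if a = s.slot 2 then c 2
  else h + ε * a / 10

/-- The slots in use: those near the gap and those of the corners. -/
def used (s : GapState) : Set ℤ := {a | GapMove.Near a ∨ ∃ j, a = s.slot j}

variable {s : GapState} {c : Fin 3 → ℝ} {h ε : ℝ}

theorem point_slot (j : Fin 3) : s.point c h ε (s.slot j) = c j := by
  rcases s.left_eq with hl | hl <;> fin_cases j <;> simp [point, slot, hl]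

theorem point_near {a : ℤ} (ha : GapMove.Near a) : s.point c h ε a = h + ε * a / 10 := by
  unfold GapMove.Near at ha
  have : ∀ j, a ≠ s.slot j := by
    intro j hj
    rcases s.left_eq with hl | hl <;> fin_cases j <;> simp [slot, hl] at hj <;> omega
  simp [point, this]

theorem abs_point_sub_lt {a : ℤ} (ha : GapMove.Near a) (hε : 0 < ε) :
    h - ε < s.point c h ε a ∧ s.point c h ε a < h + ε := by
  rw [point_near ha]
  have h1 : (-10 : ℝ) < a := by exact_mod_cast ha.1
  have h2 : (a : ℝ) < 10 := by exact_mod_cast ha.2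
  constructor <;> nlinarith

theorem strictMonoOn_point (hp : GapMove.Placed s c h) (hε : 0 < ε)
    (hc : ∀ j, c j ≤ h - ε ∨ h + ε ≤ c j) : StrictMonoOn (s.point c h ε) s.used := by
  have hcorner : ∀ j, (s.slot j ≤ -10 ∧ c j ≤ h - ε) ∨ (10 ≤ s.slot j ∧ h + ε ≤ c j) := by
    intro j
    have := hp.2 j
    rcases s.left_eq with hl | hl <;> fin_cases j <;> simp [hl, slot] at this ⊢ <;>
      rcases hc 0 <;> rcases hc 1 <;> rcases hc 2 <;> linarith
  intro a ha b hb hab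
  rcases ha with ha | ⟨i, rfl⟩ <;> rcases hb with hb | ⟨j, rfl⟩
  · rw [point_near ha, point_near hb]
    have : (a : ℝ) < b := by exact_mod_cast hab
    nlinarith
  · rw [point_slot]
    have := abs_point_sub_lt (s := s) (c := c) (h := h) ha hε
    unfold GapMove.Near at ha
    rcases hcorner j with h1 | h1
    · omega
    · linarith
  · rw [point_slot]
    have := abs_point_sub_lt (s := s) (c := c) (h := h) hb hε
    unfold GapMove.Near at hb
    rcases hcorner i with h1 | h1
    · linarith
    · omega
  · rw [point_slot, point_slot]
    have hij : i < j := by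
      rcases s.left_eq with hl | hl <;> fin_cases i <;> fin_cases j <;> simp [slot, hl] at hab ⊢
    have hmono : StrictMono c := Fin.strictMono_iff_lt_succ.2 fun k => by
      fin_cases k
      exacts [hp.1.1, hp.1.2]
    exact hmono hij

end GapState

/-- Replacing the arcs that end in a gap by arcs that end nearby creates no crossings. -/
theorem NonCrossing.blow_up {K : Set (ℝ × ℝ)} {s : GapState} {see : Fin 3 → Bool} {c : Fin 3 → ℝ}
    {h ε : ℝ} {l : List (ℤ × ℤ)} (hK : NonCrossing (K ∪ sightArcs see c h))
    (hp : GapMove.Placed s c h) (hε : 0 < ε) (hc : ∀ j, c j ≤ h - ε ∨ h + ε ≤ c j)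
    (hend : ∀ p ∈ K, (p.1 ≤ h - ε ∨ h + ε ≤ p.1) ∧ (p.2 ≤ h - ε ∨ h + ε ≤ p.2))
    (hl : GapMove.ArcsFit s see l) :
    NonCrossing (K ∪ {p | ∃ a ∈ l, p = (s.point c h ε a.1, s.point c h ε a.2)}) := by
  have hmono := GapState.strictMonoOn_point hp hε hc
  have hused : ∀ a ∈ l, a.1 ∈ s.used ∧ a.2 ∈ s.used := by
    intro a ha
    rcases (hl.2 a ha).2 with h1 | ⟨h1, j, -, h2⟩ | ⟨h1, j, -, h2⟩
    · exact ⟨.inl h1.1, .inl h1.2⟩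
    · exact ⟨.inl h1, .inr ⟨j, h2⟩⟩
    · exact ⟨.inr ⟨j, h2⟩, .inl h1⟩
  have key : ∀ p ∈ K, ∀ a ∈ l, ¬ Interleaved p (s.point c h ε a.1, s.point c h ε a.2) ∧
      ¬ Interleaved (s.point c h ε a.1, s.point c h ε a.2) p := by
    intro p hpK a ha
    obtain ⟨e1, e2⟩ := hend p hpK
    have hlt := hmono (hused a ha).1 (hused a ha).2 (hl.2 a ha).1
    rcases (hl.2 a ha).2 with h1 | ⟨h1, j, hj, h2⟩ | ⟨h1, j, hj, h2⟩
    · have b1 := GapState.abs_point_sub_lt (s := s) (c := c) (h := h) h1.1 hε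
      have b2 := GapState.abs_point_sub_lt (s := s) (c := c) (h := h) h1.2 hε
      refine ⟨fun hi => ?_, fun hi => ?_⟩ <;> unfold Interleaved at hi <;> dsimp only at hi <;>
        rcases e1 with e1 | e1 <;> rcases e2 with e2 | e2 <;> linarith
    · have b1 := GapState.abs_point_sub_lt (s := s) (c := c) (h := h) h1 hε
      rw [h2, GapState.point_slot] at hlt ⊢
      have hhc : h + ε ≤ c j := (hc j).resolve_left fun h3 => by linarith
      have hmem : (h, c j) ∈ K ∪ sightArcs see c h :=
        .inr ⟨j, hj, by rw [min_eq_right (by linarith), max_eq_left (by linarith)]⟩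
      have n1 := hK p (.inl hpK) _ hmem
      have n2 := hK _ hmem p (.inl hpK)
      refine ⟨fun hi => n1 ?_, fun hi => n2 ?_⟩ <;> unfold Interleaved at hi ⊢ <;>
        dsimp only at hi ⊢ <;> rcases e1 with e1 | e1 <;> rcases e2 with e2 | e2 <;>
        refine ⟨?_, ?_, ?_⟩ <;> linarith
    · have b1 := GapState.abs_point_sub_lt (s := s) (c := c) (h := h) h1 hε
      rw [h2, GapState.point_slot] at hlt ⊢
      have hhc : c j ≤ h - ε := (hc j).resolve_right fun h3 => by linarith
      have hmem : (c j, h) ∈ K ∪ sightArcs see c h :=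
        .inr ⟨j, hj, by rw [min_eq_left (by linarith), max_eq_right (by linarith)]⟩
      have n1 := hK p (.inl hpK) _ hmem
      have n2 := hK _ hmem p (.inl hpK)
      refine ⟨fun hi => n1 ?_, fun hi => n2 ?_⟩ <;> unfold Interleaved at hi ⊢ <;>
        dsimp only at hi ⊢ <;> rcases e1 with e1 | e1 <;> rcases e2 with e2 | e2 <;>
        refine ⟨?_, ?_, ?_⟩ <;> linarith
  rintro p (hpK | ⟨a, ha, rfl⟩) q (hqK | ⟨b, hb, rfl⟩)
  · exact hK p (.inl hpK) q (.inl hqK)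
  · exact (key p hpK b hb).1
  · exact (key q hqK a ha).2
  · rintro ⟨i1, i2, i3⟩
    have ua := hused a ha
    have ub := hused b hb
    exact hl.1 a ha b hb ⟨(hmono.lt_iff_lt ua.1 ub.1).1 i1, (hmono.lt_iff_lt ub.1 ua.2).1 i2,
      (hmono.lt_iff_lt ua.2 ub.2).1 i3⟩

/-! ### Partial diagrams with gaps -/

namespace ArcDiagram

variable {V : Type}

/-- The halfcircles above the spine of a set of edges. -/
def upperSet (A : ArcDiagram V) (E : Set (Sym2 V)) : Set (ℝ × ℝ) := {p | ∃ e ∈ E, p ∈ A.upperArcs e}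

/-- The halfcircles below the spine of a set of edges. -/
def lowerSet (A : ArcDiagram V) (E : Set (Sym2 V)) : Set (ℝ × ℝ) := {p | ∃ e ∈ E, p ∈ A.lowerArcs e}

/-- `A` draws the vertices `S` and the edges `E` without crossings, avoiding the reserved points
`X` of the spine and the reserved arcs `U` above and `D` below the spine. -/
structure Draws (A : ArcDiagram V) (S : Set V) (E : Set (Sym2 V)) (X : Set ℝ)
    (U D : Set (ℝ × ℝ)) : Prop where
  mem_of_mem_edge : ∀ e ∈ E, ∀ v ∈ e, v ∈ S
  finite_reserved : X.Finite
  injOn_pos : Set.InjOn A.pos S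
  pos_notMem : ∀ v ∈ S, A.pos v ∉ X
  cross : ∀ e ∈ E, A.kind e = ArcKind.biarc → A.lo e < A.crossPt e ∧ A.crossPt e < A.hi e ∧
    (∀ v ∈ S, A.crossPt e ≠ A.pos v) ∧ A.crossPt e ∉ X
  cross_ne : ∀ e ∈ E, ∀ f ∈ E, e ≠ f → A.kind e = ArcKind.biarc → A.kind f = ArcKind.biarc →
    A.crossPt e ≠ A.crossPt f
  upper : NonCrossing (A.upperSet E ∪ U)
  lower : NonCrossing (A.lowerSet E ∪ D)

/-- `A'` draws the vertices `S` and the edges `E` in the same way as `A`. -/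
structure AgreesOn (A A' : ArcDiagram V) (S : Set V) (E : Set (Sym2 V)) : Prop where
  pos_eq : ∀ v ∈ S, A'.pos v = A.pos v
  kind_eq : ∀ e ∈ E, A'.kind e = A.kind e
  crossPt_eq : ∀ e ∈ E, A'.crossPt e = A.crossPt e

/-- All arcs of the family end in points of `P`. -/
def EndsIn (K : Set (ℝ × ℝ)) (P : Set ℝ) : Prop := ∀ p ∈ K, p.1 ∈ P ∧ p.2 ∈ P

theorem EndsIn.mono {K : Set (ℝ × ℝ)} {P Q : Set ℝ} (h : EndsIn K P) (hPQ : P ⊆ Q) : EndsIn K Q :=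
  fun p hp => ⟨hPQ (h p hp).1, hPQ (h p hp).2⟩

section Agrees

variable {A A' A'' : ArcDiagram V} {S T : Set V} {E F : Set (Sym2 V)}

theorem AgreesOn.refl (A : ArcDiagram V) (S : Set V) (E : Set (Sym2 V)) : A.AgreesOn A S E :=
  ⟨fun _ _ => rfl, fun _ _ => rfl, fun _ _ => rfl⟩

theorem AgreesOn.trans (h : A.AgreesOn A' S E) (h' : A'.AgreesOn A'' T F) (hST : S ⊆ T)
    (hEF : E ⊆ F) : A.AgreesOn A'' S E :=
  ⟨fun v hv => (h'.pos_eq v (hST hv)).trans (h.pos_eq v hv),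
    fun e he => (h'.kind_eq e (hEF he)).trans (h.kind_eq e he),
    fun e he => (h'.crossPt_eq e (hEF he)).trans (h.crossPt_eq e he)⟩

theorem AgreesOn.lo_eq (h : A.AgreesOn A' S E) {e : Sym2 V} (he : ∀ v ∈ e, v ∈ S) :
    A'.lo e = A.lo e := by
  induction e with
  | h a b => simp [lo, h.pos_eq a (he a (by simp)), h.pos_eq b (he b (by simp))]

theorem AgreesOn.hi_eq (h : A.AgreesOn A' S E) {e : Sym2 V} (he : ∀ v ∈ e, v ∈ S) :
    A'.hi e = A.hi e := by
  induction e with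
  | h a b => simp [hi, h.pos_eq a (he a (by simp)), h.pos_eq b (he b (by simp))]

theorem AgreesOn.upperArcs_eq (h : A.AgreesOn A' S E) {e : Sym2 V} (hE : e ∈ E)
    (he : ∀ v ∈ e, v ∈ S) : A'.upperArcs e = A.upperArcs e := by
  simp only [upperArcs, h.lo_eq he, h.hi_eq he, h.kind_eq e hE, h.crossPt_eq e hE]

theorem AgreesOn.lowerArcs_eq (h : A.AgreesOn A' S E) {e : Sym2 V} (hE : e ∈ E)
    (he : ∀ v ∈ e, v ∈ S) : A'.lowerArcs e = A.lowerArcs e := by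
  simp only [lowerArcs, h.lo_eq he, h.hi_eq he, h.kind_eq e hE, h.crossPt_eq e hE]

theorem AgreesOn.image_pos (h : A.AgreesOn A' S E) : A'.pos '' S = A.pos '' S :=
  Set.image_congr h.pos_eq

end Agrees

variable {A : ArcDiagram V} {S : Set V} {E : Set (Sym2 V)} {X : Set ℝ} {U D : Set (ℝ × ℝ)}

theorem Draws.mono {X' : Set ℝ} {U' D' : Set (ℝ × ℝ)} (H : A.Draws S E X U D) (hX : X' ⊆ X)
    (hU : U' ⊆ U) (hD : D' ⊆ D) : A.Draws S E X' U' D' where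
  mem_of_mem_edge := H.mem_of_mem_edge
  finite_reserved := H.finite_reserved.subset hX
  injOn_pos := H.injOn_pos
  pos_notMem v hv hvX := H.pos_notMem v hv (hX hvX)
  cross e he hk := by
    obtain ⟨h1, h2, h3, h4⟩ := H.cross e he hk
    exact ⟨h1, h2, h3, fun h => h4 (hX h)⟩
  cross_ne := H.cross_ne
  upper := H.upper.mono (Set.union_subset_union_right _ hU)
  lower := H.lower.mono (Set.union_subset_union_right _ hD)

theorem lo_mem_image (A : ArcDiagram V) {S : Set V} {e : Sym2 V} (he : ∀ v ∈ e, v ∈ S) :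
    A.lo e ∈ A.pos '' S := by
  induction e with
  | h a b =>
    rcases min_choice (A.pos a) (A.pos b) with h | h
    · exact ⟨a, he a (by simp), h.symm⟩
    · exact ⟨b, he b (by simp), h.symm⟩

theorem hi_mem_image (A : ArcDiagram V) {S : Set V} {e : Sym2 V} (he : ∀ v ∈ e, v ∈ S) :
    A.hi e ∈ A.pos '' S := by
  induction e with
  | h a b =>
    rcases max_choice (A.pos a) (A.pos b) with h | h
    · exact ⟨a, he a (by simp), h.symm⟩
    · exact ⟨b, he b (by simp), h.symm⟩

/-- The vertices and the spine crossings of a diagram. -/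
def spinePoints (A : ArcDiagram V) (S : Set V) (E : Set (Sym2 V)) : Set ℝ :=
  A.pos '' S ∪ A.crossPt '' {e | e ∈ E ∧ A.kind e = ArcKind.biarc}

theorem Draws.endsIn_upperSet (H : A.Draws S E X U D) :
    EndsIn (A.upperSet E) (A.spinePoints S E) := by
  rintro p ⟨e, he, hp⟩
  have h1 := A.lo_mem_image (H.mem_of_mem_edge e he)
  have h2 := A.hi_mem_image (H.mem_of_mem_edge e he)
  unfold upperArcs at hp
  split at hp
  · rw [List.mem_singleton.1 hp]; exact ⟨.inl h1, .inl h2⟩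
  · simp at hp
  · next hk => rw [List.mem_singleton.1 hp]; exact ⟨.inr ⟨e, ⟨he, hk⟩, rfl⟩, .inl h2⟩

theorem Draws.endsIn_lowerSet (H : A.Draws S E X U D) :
    EndsIn (A.lowerSet E) (A.spinePoints S E) := by
  rintro p ⟨e, he, hp⟩
  have h1 := A.lo_mem_image (H.mem_of_mem_edge e he)
  have h2 := A.hi_mem_image (H.mem_of_mem_edge e he)
  unfold lowerArcs at hp
  split at hp
  · simp at hp
  · rw [List.mem_singleton.1 hp]; exact ⟨.inl h1, .inl h2⟩
  · next hk => rw [List.mem_singleton.1 hp]; exact ⟨.inl h1, .inr ⟨e, ⟨he, hk⟩, rfl⟩⟩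

theorem Draws.notMem_spinePoints (H : A.Draws S E X U D) {h : ℝ} (hh : h ∈ X) :
    h ∉ A.spinePoints S E := by
  rintro (⟨v, hv, rfl⟩ | ⟨e, ⟨he, hk⟩, rfl⟩)
  · exact H.pos_notMem v hv hh
  · exact (H.cross e he hk).2.2.2 hh

theorem exists_gap_radius {P : Set ℝ} (hP : P.Finite) (h : ℝ) (hh : h ∉ P) :
    ∃ ε > 0, ∀ p ∈ P, p ≤ h - ε ∨ h + ε ≤ p := by
  obtain ⟨ε, hε, hsub⟩ := Metric.isOpen_iff.1 hP.isClosed.isOpen_compl h hh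
  refine ⟨ε, hε, fun p hp => ?_⟩
  by_contra hcon
  push Not at hcon
  exact hsub (show p ∈ Metric.ball h ε by
    rw [Metric.mem_ball, Real.dist_eq, abs_lt]; constructor <;> linarith) hp

/-- The sight lines of the faces created by a move. -/
def newSights [DecidableEq V] (A : ArcDiagram V) (see : GapState → Fin 3 → Bool) (m : GapMove)
    (c : Fin 3 → V) (x : V) (g : Fin 3 → ℝ) (i : Fin 3) : Set (ℝ × ℝ) :=
  sightArcs (see (m.next i)) (A.pos ∘ Function.update c i x ∘ m.perm i) (g i)

theorem Draws.insert_vertex [Finite V] [DecidableEq V] {c : Fin 3 → V} {h : ℝ} {s : GapState}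
    {m : GapMove} {x : V} (hm : m.Legal s) (hx : x ∉ S) (hcS : ∀ i, c i ∈ S)
    (hc : Function.Injective c) (hX : h ∉ X) (hp : GapMove.Placed s (A.pos ∘ c) h)
    (hU : EndsIn U (A.pos '' S ∪ X)) (hD : EndsIn D (A.pos '' S ∪ X))
    (H : A.Draws S E (insert h X) (U ∪ sightArcs s.up (A.pos ∘ c) h)
      (D ∪ sightArcs s.down (A.pos ∘ c) h)) :
    ∃ (A' : ArcDiagram V) (g : Fin 3 → ℝ), A.AgreesOn A' S E ∧
      (∀ i, A'.kind s(x, c i) = m.kind i) ∧ Function.Injective g ∧ (∀ i, g i ∉ X) ∧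
      (∀ i, (m.next i).shape ≠ .dead →
        GapMove.Placed (m.next i) (A'.pos ∘ Function.update c i x ∘ m.perm i) (g i)) ∧
      A'.Draws (insert x S) (E ∪ Set.range fun i => s(x, c i)) (X ∪ Set.range g)
        (U ∪ ⋃ i, A'.newSights GapState.up m c x g i)
        (D ∪ ⋃ i, A'.newSights GapState.down m c x g i) := by
  obtain ⟨hgap, hgapne, hcr, hcrne, hup, hdn⟩ := hm
  have hhS : h ∉ A.spinePoints S E := H.notMem_spinePoints (Set.mem_insert h X)
  have hXfin : X.Finite := H.finite_reserved.subset (Set.subset_insert _ _)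
  have hPfin : (A.spinePoints S E ∪ X).Finite :=
    (((Set.toFinite S).image _).union ((Set.toFinite _).image _)).union hXfin
  obtain ⟨ε, hε, hfar⟩ := exists_gap_radius hPfin h (fun hh => hh.elim hhS hX)
  have hsubP : A.pos '' S ∪ X ⊆ A.spinePoints S E ∪ X :=
    Set.union_subset_union_left _ Set.subset_union_left
  have hfarc : ∀ j, (A.pos ∘ c) j ≤ h - ε ∨ h + ε ≤ (A.pos ∘ c) j := fun j =>
    hfar _ (.inl (.inl ⟨c j, hcS j, rfl⟩))
  set ψ : ℤ → ℝ := s.point (A.pos ∘ c) h ε with hψ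
  have hmono : StrictMonoOn ψ s.used := GapState.strictMonoOn_point hp hε hfarc
  have hψ0 : ψ 0 = h := by
    rw [hψ, GapState.point_near (by decide)]; simp
  have hψs : ∀ j, ψ (s.slot j) = A.pos (c j) := fun j => GapState.point_slot j
  have hu0 : (0 : ℤ) ∈ s.used := .inl (by decide)
  have hus : ∀ j, s.slot j ∈ s.used := fun j => .inr ⟨j, rfl⟩
  have hnear : ∀ a, GapMove.Near a → ψ a ∉ A.spinePoints S E ∪ X := by
    intro a ha hmem
    have := GapState.abs_point_sub_lt (s := s) (c := A.pos ∘ c) (h := h) ha hε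
    rcases hfar _ hmem with h1 | h1 <;> linarith
  have hedge : Function.Injective fun i => s(x, c i) := by
    intro i j hij
    rcases Sym2.eq_iff.1 hij with h1 | h1
    · exact hc h1.2
    · exact absurd (h1.1 ▸ hcS j) hx
  have hnew : ∀ e ∈ E, ∀ i, s(x, c i) ≠ e := fun e he i hei =>
    hx (H.mem_of_mem_edge e he x (hei ▸ Sym2.mem_mk_left _ _))
  let A' : ArcDiagram V :=
    { pos := Function.update A.pos x h
      kind := Function.extend (fun i => s(x, c i)) m.kind A.kind
      crossPt := Function.extend (fun i => s(x, c i)) (fun i => ψ (m.cross i)) A.crossPt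
      credit := A.credit }
  have hAA' : A.AgreesOn A' S E := by
    have hne : ∀ e ∈ E, ¬ ∃ i, s(x, c i) = e := fun e he ⟨i, hi⟩ => hnew e he i hi
    exact ⟨fun v hv => Function.update_of_ne (ne_of_mem_of_not_mem hv hx) _ _,
      fun e he => Function.extend_apply' m.kind A.kind e (hne e he),
      fun e he => Function.extend_apply' (fun i => ψ (m.cross i)) A.crossPt e (hne e he)⟩
  have hkind : ∀ i, A'.kind s(x, c i) = m.kind i := fun i => hedge.extend_apply m.kind A.kind i
  have hcross : ∀ i, A'.crossPt s(x, c i) = ψ (m.cross i) := fun i =>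
    hedge.extend_apply (fun i => ψ (m.cross i)) A.crossPt i
  have hposx : A'.pos x = ψ 0 := by rw [hψ0]; exact Function.update_self ..
  have hposc : ∀ i, A'.pos (c i) = ψ (s.slot i) := fun i => by
    rw [hψs]; exact hAA'.pos_eq _ (hcS i)
  have hlo : ∀ i, A'.lo s(x, c i) = ψ (min (s.slot i) 0) := fun i => by
    rw [hmono.monotoneOn.map_min (hus i) hu0, ← hposx, ← hposc, min_comm]; rfl
  have hhi : ∀ i, A'.hi s(x, c i) = ψ (max (s.slot i) 0) := fun i => by
    rw [hmono.monotoneOn.map_max (hus i) hu0, ← hposx, ← hposc, max_comm]; rfl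
  have hchild : ∀ i j, (A'.pos ∘ Function.update c i x ∘ m.perm i) j = ψ (m.childSlot s i j) := by
    intro i j
    simp only [Function.comp_apply, GapMove.childSlot]
    split_ifs with hij
    · rw [hij, Function.update_self, hposx]
    · rw [Function.update_of_ne hij, hposc]
  have huc : ∀ i j, m.childSlot s i j ∈ s.used := by
    intro i j
    unfold GapMove.childSlot
    split_ifs
    exacts [hu0, hus _]
  have hug : ∀ i, m.gap i ∈ s.used := fun i => .inl (hgap i).1
  have hgoodcross : ∀ i, m.kind i = .biarc → m.cross i ∈ s.used := fun i hi => .inl (hcr i hi).1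
  have hsight : ∀ (see : GapState → Fin 3 → Bool) (i : Fin 3) (p : ℝ × ℝ),
      p ∈ A'.newSights see m c x (fun i => ψ (m.gap i)) i → ∃ j, see (m.next i) j = true ∧
        p = (ψ (min (m.childSlot s i j) (m.gap i)), ψ (max (m.childSlot s i j) (m.gap i))) := by
    rintro see i p ⟨j, hj, rfl⟩
    refine ⟨j, hj, ?_⟩
    rw [hchild, hmono.monotoneOn.map_min (huc i j) (hug i),
      hmono.monotoneOn.map_max (huc i j) (hug i)]
  refine ⟨A', fun i => ψ (m.gap i), hAA', hkind, ?_, ?_, ?_, ?_⟩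
  · intro i j hij
    by_contra hne
    exact hgapne i j hne (hmono.injOn (hug i) (hug j) hij)
  · exact fun i hi => hnear _ (hgap i).1 (.inr hi)
  · intro i hi
    have hpl := (hgap i).2.2.2 hi
    refine ⟨⟨?_, ?_⟩, fun j => ?_⟩
    · rw [hchild, hchild]; exact hmono (huc _ _) (huc _ _) hpl.1.1
    · rw [hchild, hchild]; exact hmono (huc _ _) (huc _ _) hpl.1.2
    · have := hpl.2 j
      rw [hchild]
      split_ifs at this ⊢
      · exact hmono (huc _ _) (hug _) this
      · exact hmono (hug _) (huc _ _) this
  · refine ⟨?_, hXfin.union (Set.finite_range _), ?_, ?_, ?_, ?_, ?_, ?_⟩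
    · rintro e (he | ⟨i, rfl⟩) v hv
      · exact .inr (H.mem_of_mem_edge e he v hv)
      · rcases Sym2.mem_iff.1 hv with rfl | rfl
        exacts [.inl rfl, .inr (hcS i)]
    · refine (Set.injOn_insert hx).2 ⟨H.injOn_pos.congr fun v hv => (hAA'.pos_eq v hv).symm, ?_⟩
      rw [hAA'.image_pos, hposx]
      exact fun hmem => hnear 0 (by decide) (.inl (.inl hmem))
    · have hXS : ∀ v ∈ insert x S, A'.pos v ∉ X := by
        rintro v (rfl | hv) hvX
        · rw [hposx] at hvX; exact hnear 0 (by decide) (.inr hvX)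
        · rw [hAA'.pos_eq v hv] at hvX; exact H.pos_notMem v hv (.inr hvX)
      rintro v hv (hvX | ⟨i, hi⟩)
      · exact hXS v hv hvX
      · rcases hv with rfl | hv
        · exact (hgap i).2.1 (hmono.injOn (hug i) hu0 (hi.trans hposx))
        · exact hnear _ (hgap i).1 (.inl (.inl ⟨v, hv, (hAA'.pos_eq v hv).symm.trans hi.symm⟩))
    · rintro e (he | ⟨i, rfl⟩) hk
      · have hke := hk
        rw [hAA'.kind_eq e he] at hke
        obtain ⟨h1, h2, h3, h4⟩ := H.cross e he hke
        have heS := H.mem_of_mem_edge e he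
        rw [hAA'.lo_eq heS, hAA'.hi_eq heS, hAA'.crossPt_eq e he]
        have hsp : A.crossPt e ∈ A.spinePoints S E := .inr ⟨e, ⟨he, hke⟩, rfl⟩
        refine ⟨h1, h2, ?_, ?_⟩
        · rintro v (rfl | hv) heq
          · rw [hposx] at heq; exact hnear 0 (by decide) (.inl (heq ▸ hsp))
          · rw [hAA'.pos_eq v hv] at heq; exact h3 v hv heq
        · rintro (hmem | ⟨i, hi⟩)
          · exact h4 (.inr hmem)
          · exact hnear _ (hgap i).1 (.inl (hi.symm ▸ hsp : (fun i => ψ (m.gap i)) i ∈ _))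
      · dsimp only at hk ⊢
        rw [hkind] at hk
        obtain ⟨h1, h2, h3, h4, h5⟩ := hcr i hk
        have hu := hgoodcross i hk
        have humin : min (s.slot i) 0 ∈ s.used := by
          rcases min_choice (s.slot i) 0 with h | h <;> rw [h]
          exacts [hus i, hu0]
        have humax : max (s.slot i) 0 ∈ s.used := by
          rcases max_choice (s.slot i) 0 with h | h <;> rw [h]
          exacts [hus i, hu0]
        rw [hlo, hhi, hcross]
        refine ⟨hmono humin hu h3, hmono hu humax h4, ?_, ?_⟩
        · rintro v (rfl | hv) heq
          · exact h2 (hmono.injOn hu hu0 (heq.trans hposx))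
          · exact hnear _ h1 (.inl (.inl ⟨v, hv, (hAA'.pos_eq v hv).symm.trans heq.symm⟩))
        · rintro (hmem | ⟨j, hj⟩)
          · exact hnear _ h1 (.inr hmem)
          · exact h5 j (hmono.injOn hu (hug j) hj.symm)
    · have hmix : ∀ e ∈ E, ∀ i, A'.kind e = .biarc → m.kind i = .biarc →
          A'.crossPt e ≠ ψ (m.cross i) := by
        intro e he i hk hki heq
        rw [hAA'.kind_eq e he] at hk
        rw [hAA'.crossPt_eq e he] at heq
        exact hnear _ (hcr i hki).1 (.inl (.inr ⟨e, ⟨he, hk⟩, heq⟩))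
      rintro e (he | ⟨i, rfl⟩) f (hf | ⟨j, rfl⟩) hef hk hk'
      · rw [hAA'.crossPt_eq e he, hAA'.crossPt_eq f hf]
        rw [hAA'.kind_eq e he] at hk
        rw [hAA'.kind_eq f hf] at hk'
        exact H.cross_ne e he f hf hef hk hk'
      · dsimp only at hk' ⊢
        rw [hkind] at hk'
        rw [hcross]
        exact hmix e he j hk hk'
      · dsimp only at hk ⊢
        rw [hkind] at hk
        rw [hcross]
        exact (hmix f hf i hk' hk).symm
      · dsimp only at hk hk' hef ⊢
        rw [hkind] at hk hk'
        rw [hcross, hcross]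
        have hij : i ≠ j := fun h => hef (h ▸ rfl)
        exact fun heq => hcrne i j hij hk hk'
          (hmono.injOn (hgoodcross i hk) (hgoodcross j hk') heq)
    · have hK : NonCrossing ((A.upperSet E ∪ U) ∪ sightArcs s.up (A.pos ∘ c) h) := by
        rw [Set.union_assoc]; exact H.upper
      refine (hK.blow_up hp hε hfarc ?_ hup).mono ?_
      · rintro p (hpE | hpU)
        · have := H.endsIn_upperSet p hpE
          exact ⟨hfar _ (.inl this.1), hfar _ (.inl this.2)⟩
        · have := hU.mono hsubP p hpU
          exact ⟨hfar _ this.1, hfar _ this.2⟩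
      · rintro p (⟨e, he | ⟨i, rfl⟩, hpe⟩ | hpU | hpN)
        · rw [hAA'.upperArcs_eq he (H.mem_of_mem_edge e he)] at hpe
          exact .inl (.inl ⟨e, he, hpe⟩)
        · right
          simp only [upperArcs, hkind, hlo, hhi, hcross] at hpe
          have hsub : ∀ a, a ∈ (match m.kind i with
              | .mountain => [(min (s.slot i) 0, max (s.slot i) 0)]
              | .pocket => []
              | .biarc => [(m.cross i, max (s.slot i) 0)]) → a ∈ m.upper s := fun a ha =>
            List.mem_append_left _ (List.mem_flatMap.2 ⟨i, List.mem_finRange i, ha⟩)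
          cases hk : m.kind i <;> rw [hk] at hpe hsub <;> simp at hpe
          · exact ⟨_, hsub _ (List.mem_singleton_self _), hpe⟩
          · exact ⟨_, hsub _ (List.mem_singleton_self _), hpe⟩
        · exact .inl (.inr hpU)
        · right
          obtain ⟨i, hi⟩ := Set.mem_iUnion.1 hpN
          obtain ⟨j, hj, rfl⟩ := hsight _ i p hi
          refine ⟨(min (m.childSlot s i j) (m.gap i), max (m.childSlot s i j) (m.gap i)),
            List.mem_append_right _ (List.mem_flatMap.2 ⟨i, List.mem_finRange i,
            List.mem_flatMap.2 ⟨j, List.mem_finRange j, ?_⟩⟩), rfl⟩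
          rw [if_pos hj]
          exact List.mem_singleton_self _
    · have hK : NonCrossing ((A.lowerSet E ∪ D) ∪ sightArcs s.down (A.pos ∘ c) h) := by
        rw [Set.union_assoc]; exact H.lower
      refine (hK.blow_up hp hε hfarc ?_ hdn).mono ?_
      · rintro p (hpE | hpD)
        · have := H.endsIn_lowerSet p hpE
          exact ⟨hfar _ (.inl this.1), hfar _ (.inl this.2)⟩
        · have := hD.mono hsubP p hpD
          exact ⟨hfar _ this.1, hfar _ this.2⟩
      · rintro p (⟨e, he | ⟨i, rfl⟩, hpe⟩ | hpD | hpN)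
        · rw [hAA'.lowerArcs_eq he (H.mem_of_mem_edge e he)] at hpe
          exact .inl (.inl ⟨e, he, hpe⟩)
        · right
          simp only [lowerArcs, hkind, hlo, hhi, hcross] at hpe
          have hsub : ∀ a, a ∈ (match m.kind i with
              | .mountain => []
              | .pocket => [(min (s.slot i) 0, max (s.slot i) 0)]
              | .biarc => [(min (s.slot i) 0, m.cross i)]) → a ∈ m.lower s := fun a ha =>
            List.mem_append_left _ (List.mem_flatMap.2 ⟨i, List.mem_finRange i, ha⟩)
          cases hk : m.kind i <;> rw [hk] at hpe hsub <;> simp at hpe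
          · exact ⟨_, hsub _ (List.mem_singleton_self _), hpe⟩
          · exact ⟨_, hsub _ (List.mem_singleton_self _), hpe⟩
        · exact .inl (.inr hpD)
        · right
          obtain ⟨i, hi⟩ := Set.mem_iUnion.1 hpN
          obtain ⟨j, hj, rfl⟩ := hsight _ i p hi
          refine ⟨(min (m.childSlot s i j) (m.gap i), max (m.childSlot s i j) (m.gap i)),
            List.mem_append_right _ (List.mem_flatMap.2 ⟨i, List.mem_finRange i,
            List.mem_flatMap.2 ⟨j, List.mem_finRange j, ?_⟩⟩), rfl⟩
          rw [if_pos hj]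
          exact List.mem_singleton_self _

end ArcDiagram

/-! ### Drawing a face tree inside a gap -/

theorem Function.Injective.update_of_forall_ne {α β : Type*} [DecidableEq α] {f : α → β}
    (hf : Function.Injective f) {b : β} (hb : ∀ a, f a ≠ b) (i : α) :
    Function.Injective (Function.update f i b) := by
  intro a a' haa'
  by_cases ha : a = i <;> by_cases ha' : a' = i
  · rw [ha, ha']
  · subst ha
    rw [Function.update_self, Function.update_of_ne ha'] at haa'
    exact absurd haa'.symm (hb a')
  · subst ha'
    rw [Function.update_self, Function.update_of_ne ha] at haa'
    exact absurd haa' (hb a)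
  · rw [Function.update_of_ne ha, Function.update_of_ne ha'] at haa'
    exact hf haa'

theorem Finset.image_update_univ {α β : Type*} [Fintype α] [DecidableEq α] [DecidableEq β]
    {f : α → β} (hf : Function.Injective f) (i : α) (b : β) :
    Finset.univ.image (Function.update f i b) = insert b ((Finset.univ.image f).erase (f i)) := by
  ext v
  simp only [Finset.mem_image, Finset.mem_univ, true_and, Finset.mem_insert, Finset.mem_erase]
  constructor
  · rintro ⟨j, rfl⟩
    by_cases hj : j = i
    · left; rw [hj, Function.update_self]
    · right
      rw [Function.update_of_ne hj]
      exact ⟨hf.ne hj, j, rfl⟩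
  · rintro (rfl | ⟨hne, j, rfl⟩)
    · exact ⟨i, Function.update_self ..⟩
    · exact ⟨j, Function.update_of_ne (fun hji => hne (congrArg f hji)) _ _⟩

namespace FaceTree

variable {V : Type}

/-- The vertices inserted by a face tree. -/
def verts : FaceTree V → Set V
  | leaf => ∅
  | node x t => insert x (⋃ i, (t i).verts)

/-- The edges inserted by a face tree in a face with corners `ℓ`. -/
def edges [DecidableEq V] : FaceTree V → (Fin 3 → V) → Set (Sym2 V)
  | leaf, _ => ∅
  | node x t, ℓ => (Set.range fun i => s(x, ℓ i)) ∪ ⋃ i, (t i).edges (Function.update ℓ i x)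

/-- The inserted vertices are pairwise distinct. -/
def Distinct : FaceTree V → Prop
  | leaf => True
  | node x t => (∀ i, x ∉ (t i).verts) ∧ (∀ i j, i ≠ j → Disjoint (t i).verts (t j).verts) ∧
      ∀ i, (t i).Distinct

end FaceTree

namespace ArcDiagram

variable {V : Type}

/-- `A` can be extended by the tree `t` inside a gap at `h`, within the budget of the gap. -/
def Fillable [DecidableEq V] (t : FaceTree V) : Prop :=
  ∀ (A : ArcDiagram V) (S : Set V) (E : Set (Sym2 V)) (X : Set ℝ) (U D : Set (ℝ × ℝ))
    (ℓ : Fin 3 → V) (π : Fin 3 → Fin 3) (s : GapState) (h : ℝ),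
    t.Distinct → Disjoint t.verts S → Function.Injective ℓ → (∀ i, ℓ i ∈ S) →
    Function.Injective π → (s.shape = .dead → t.size = 0) →
    (s.shape ≠ .dead → GapMove.Placed s (A.pos ∘ ℓ ∘ π) h) → h ∉ X →
    EndsIn U (A.pos '' S ∪ X) → EndsIn D (A.pos '' S ∪ X) →
    A.Draws S E (insert h X) (U ∪ sightArcs s.up (A.pos ∘ ℓ ∘ π) h)
      (D ∪ sightArcs s.down (A.pos ∘ ℓ ∘ π) h) →
    ∃ A' : ArcDiagram V, A.AgreesOn A' S E ∧ A'.Draws (S ∪ t.verts) (E ∪ t.edges ℓ) X U D ∧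
      {e | e ∈ t.edges ℓ ∧ A'.kind e = .biarc}.ncard ≤ t.stateBudget s π

theorem endsIn_newSights [DecidableEq V] {A : ArcDiagram V} {see : GapState → Fin 3 → Bool}
    {m : GapMove} {c : Fin 3 → V} {x : V} {g : Fin 3 → ℝ} {S : Set V} {X : Set ℝ} {i : Fin 3}
    (hcS : ∀ i, c i ∈ S) (hx : x ∈ S) (hg : g i ∈ X) :
    EndsIn (A.newSights see m c x g i) (A.pos '' S ∪ X) := by
  rintro p ⟨j, -, rfl⟩
  have hc : (A.pos ∘ Function.update c i x ∘ m.perm i) j ∈ A.pos '' S := by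
    refine ⟨_, ?_, rfl⟩
    simp only [Function.comp_apply, Function.update_apply]
    split_ifs
    exacts [hx, hcS _]
  constructor
  · dsimp only
    rcases min_choice ((A.pos ∘ Function.update c i x ∘ m.perm i) j) (g i) with h | h <;> rw [h]
    exacts [.inl hc, .inr hg]
  · dsimp only
    rcases max_choice ((A.pos ∘ Function.update c i x ∘ m.perm i) j) (g i) with h | h <;> rw [h]
    exacts [.inl hc, .inr hg]

theorem EndsIn.union {K L : Set (ℝ × ℝ)} {P : Set ℝ} (hK : EndsIn K P) (hL : EndsIn L P) :
    EndsIn (K ∪ L) P := by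
  rintro p (hp | hp)
  exacts [hK p hp, hL p hp]

theorem ncard_biarc_range_le [DecidableEq V] {A : ArcDiagram V} {m : GapMove} {c : Fin 3 → V}
    {x : V} (hk : ∀ i, A.kind s(x, c i) = m.kind i) :
    {e | e ∈ (Set.range fun i => s(x, c i)) ∧ A.kind e = .biarc}.ncard ≤ m.cost := by
  have hcost : m.cost = (Finset.univ.filter fun i => m.kind i = .biarc).card := by
    rw [Finset.card_filter, Fin.sum_univ_three]; rfl
  have hsub : {e | e ∈ (Set.range fun i => s(x, c i)) ∧ A.kind e = .biarc} ⊆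
      (((Finset.univ.filter fun i => m.kind i = .biarc).image fun i => s(x, c i) :
        Finset (Sym2 V)) : Set (Sym2 V)) := by
    rintro e ⟨⟨i, rfl⟩, hi⟩
    simp only [Finset.coe_image, Finset.coe_filter, Finset.mem_univ, true_and]
    exact ⟨i, (hk i).symm.trans hi, rfl⟩
  refine (Set.ncard_le_ncard hsub (Finset.finite_toSet _)).trans ?_
  rw [Set.ncard_coe_finset, hcost]
  exact Finset.card_image_le

/-- Filling the new gaps of `I` one after the other. -/
theorem Draws.fill_gaps [Finite V] [DecidableEq V] {A : ArcDiagram V} {S : Set V}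
    {E : Set (Sym2 V)} {X : Set ℝ} {U D : Set (ℝ × ℝ)} {t : Fin 3 → FaceTree V}
    {ℓ : Fin 3 → V} {π : Fin 3 → Fin 3} {m : GapMove} {x : V} {g : Fin 3 → ℝ}
    (ih : ∀ i, Fillable (t i)) (hx : ∀ i, ℓ i ≠ x) (hxS : x ∈ S) (hℓ : Function.Injective ℓ)
    (hℓS : ∀ i, ℓ i ∈ S) (hπ : Function.Injective π)
    (hdist : ∀ i j, i ≠ j → Disjoint (t i).verts (t j).verts) (hdis : ∀ i, (t i).Distinct)
    (htS : ∀ i, Disjoint (t i).verts S) (hperm : ∀ i, Function.Injective (m.perm i))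
    (hdead : ∀ i, (m.next i).shape = .dead → (t (π i)).size = 0) (hg : Function.Injective g)
    (hgX : ∀ i, g i ∉ X)
    (hpl : ∀ i, (m.next i).shape ≠ .dead →
        GapMove.Placed (m.next i) (A.pos ∘ Function.update (ℓ ∘ π) i x ∘ m.perm i) (g i))
    (hU : EndsIn U (A.pos '' S ∪ X)) (hD : EndsIn D (A.pos '' S ∪ X))
    (H : A.Draws S E (X ∪ Set.range g) (U ∪ ⋃ i, A.newSights GapState.up m (ℓ ∘ π) x g i)
        (D ∪ ⋃ i, A.newSights GapState.down m (ℓ ∘ π) x g i)) (I : Finset (Fin 3)) :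
    ∃ A' : ArcDiagram V, A.AgreesOn A' S E ∧
      A'.Draws (S ∪ ⋃ i ∈ I, (t (π i)).verts)
        (E ∪ ⋃ i ∈ I, (t (π i)).edges (Function.update ℓ (π i) x)) (X ∪ g '' {i | i ∉ I})
        (U ∪ ⋃ i ∈ {i | i ∉ I}, A.newSights GapState.up m (ℓ ∘ π) x g i)
        (D ∪ ⋃ i ∈ {i | i ∉ I}, A.newSights GapState.down m (ℓ ∘ π) x g i) ∧
      {e | e ∈ (⋃ i ∈ I, (t (π i)).edges (Function.update ℓ (π i) x)) ∧
        A'.kind e = .biarc}.ncard ≤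
          ∑ i ∈ I, (t (π i)).stateBudget (m.next i) (π ∘ m.perm i) := by
  induction I using Finset.induction_on with
  | empty => exact ⟨A, AgreesOn.refl A S E, by simpa using H, by simp⟩
  | insert i I hi ihI =>
    obtain ⟨B, hAB, HB, hcount⟩ := ihI
    have hpos : B.pos ∘ Function.update ℓ (π i) x ∘ π ∘ m.perm i =
        A.pos ∘ Function.update (ℓ ∘ π) i x ∘ m.perm i := by
      rw [← Function.update_comp_eq_of_injective _ hπ]
      funext j
      refine hAB.pos_eq _ ?_
      simp only [Function.comp_apply, Function.update_apply]
      split_ifs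
      exacts [hxS, hℓS _]
    have himg : A.pos '' S ⊆ B.pos '' (S ∪ ⋃ i ∈ I, (t (π i)).verts) := by
      rw [← hAB.image_pos]; exact Set.image_mono Set.subset_union_left
    have hends : ∀ (see : GapState → Fin 3 → Bool) (W : Set (ℝ × ℝ)),
        EndsIn W (A.pos '' S ∪ X) →
        EndsIn (W ∪ ⋃ j ∈ {j | j ∉ insert i I}, A.newSights see m (ℓ ∘ π) x g j)
          (B.pos '' (S ∪ ⋃ i ∈ I, (t (π i)).verts) ∪ (X ∪ g '' {j | j ∉ insert i I})) := by
      intro see W hW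
      refine (hW.mono (Set.union_subset_union himg Set.subset_union_left)).union ?_
      intro p hp
      obtain ⟨j, hj, hp⟩ := Set.mem_iUnion₂.1 hp
      exact (endsIn_newSights (fun i => hℓS (π i)) hxS
        (Set.mem_union_right X (Set.mem_image_of_mem g hj))).mono
        (Set.union_subset_union_left _ himg) p hp
    have hsights : ∀ (see : GapState → Fin 3 → Bool) (W : Set (ℝ × ℝ)),
        (W ∪ ⋃ j ∈ {j | j ∉ insert i I}, A.newSights see m (ℓ ∘ π) x g j) ∪
          sightArcs (see (m.next i)) (B.pos ∘ Function.update ℓ (π i) x ∘ π ∘ m.perm i) (g i) ⊆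
        W ∪ ⋃ j ∈ {j | j ∉ I}, A.newSights see m (ℓ ∘ π) x g j := by
      intro see W p hp
      rcases hp with (hp | hp) | hp
      · exact .inl hp
      · obtain ⟨j, hj, hp⟩ := Set.mem_iUnion₂.1 hp
        exact .inr (Set.mem_iUnion₂.2 ⟨j, fun hjI => hj (Finset.mem_insert_of_mem hjI), hp⟩)
      · rw [hpos] at hp
        exact .inr (Set.mem_iUnion₂.2 ⟨i, hi, hp⟩)
    obtain ⟨A', hBA', HA', hc⟩ := ih (π i) B _ _ (X ∪ g '' {j | j ∉ insert i I}) _ _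
      (Function.update ℓ (π i) x) (π ∘ m.perm i) (m.next i) (g i) (hdis _)
      (by
        refine Set.disjoint_union_right.2 ⟨htS _, Set.disjoint_iUnion₂_right.2 fun j hj => ?_⟩
        exact hdist _ _ (hπ.ne (ne_of_mem_of_not_mem hj hi).symm))
      (hℓ.update_of_forall_ne hx _)
      (fun j => by
        simp only [Function.update_apply]
        split_ifs
        exacts [.inl hxS, .inl (hℓS _)])
      (hπ.comp (hperm i)) (hdead i) (fun h => hpos ▸ hpl i h)
      (by
        rintro (h | ⟨j, hj, h⟩)
        · exact hgX i h
        · exact hj (hg h ▸ Finset.mem_insert_self i I))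
      (hends GapState.up U hU) (hends GapState.down D hD)
      (HB.mono (by
        rintro p (rfl | hp | ⟨j, hj, rfl⟩)
        · exact .inr ⟨i, hi, rfl⟩
        · exact .inl hp
        · exact .inr ⟨j, fun hjI => hj (Finset.mem_insert_of_mem hjI), rfl⟩)
        (hsights GapState.up U) (hsights GapState.down D))
    refine ⟨A', hAB.trans hBA' Set.subset_union_left Set.subset_union_left, ?_, ?_⟩
    · rw [Finset.set_biUnion_insert, Finset.set_biUnion_insert, Set.union_comm (t (π i)).verts,
        Set.union_comm ((t (π i)).edges _), ← Set.union_assoc, ← Set.union_assoc]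
      exact HA'
    · rw [Finset.sum_insert hi, Finset.set_biUnion_insert]
      refine le_trans ?_ (add_le_add hc hcount)
      refine (Set.ncard_le_ncard ?_ (Set.toFinite _)).trans (Set.ncard_union_le _ _)
      rintro e ⟨he | he, hk⟩
      · exact .inl ⟨he, hk⟩
      · exact .inr ⟨he, (hBA'.kind_eq e (.inr he)).symm.trans hk⟩

theorem fillable [Finite V] [DecidableEq V] (t : FaceTree V) : Fillable t := by
  induction t with
  | leaf =>
    intro A S E X U D ℓ π s h _ _ _ _ _ _ _ _ _ _ H
    refine ⟨A, AgreesOn.refl A S E, ?_, by simp [FaceTree.edges]⟩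
    simpa [FaceTree.verts, FaceTree.edges] using
      H.mono (Set.subset_insert h X) Set.subset_union_left Set.subset_union_left
  | node x t ih =>
    intro A S E X U D ℓ π s h hdist hdisj hℓ hℓS hπ hdead hpl hX hU hD H
    have hs : s.shape ≠ .dead := fun hs => by
      have := hdead hs
      simp [FaceTree.size] at this
    obtain ⟨m, hm, hmdead, hmB⟩ := FaceTree.exists_affordable_move x t hπ s hs
    have hleg := s.legal_of_mem_moves m hm
    have hxS : x ∉ S := Set.disjoint_left.1 hdisj (Set.mem_insert _ _)
    obtain ⟨A₁, g, hA₁, hk, hg, hgX, hpl₁, H₁⟩ := H.insert_vertex (c := ℓ ∘ π) hleg hxS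
      (fun i => hℓS _) (hℓ.comp hπ) hX (hpl hs) hU hD
    have himg : A.pos '' S ∪ X ⊆ A₁.pos '' (insert x S) ∪ X := by
      rw [← hA₁.image_pos]
      exact Set.union_subset_union_left _ (Set.image_mono (Set.subset_insert _ _))
    obtain ⟨A₂, hA₂, H₂, hcount⟩ := H₁.fill_gaps (t := t) (ℓ := ℓ) (π := π) ih
      (fun i => ne_of_mem_of_not_mem (hℓS i) hxS) (Set.mem_insert _ _) hℓ
      (fun i => Set.mem_insert_of_mem _ (hℓS i)) hπ hdist.2.1 hdist.2.2
      (fun i => by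
        rw [Set.insert_eq, Set.disjoint_union_right, Set.disjoint_singleton_right]
        exact ⟨hdist.1 i, hdisj.mono_left
          ((Set.subset_iUnion (fun i => (t i).verts) i).trans (Set.subset_insert _ _))⟩)
      (fun i => (hleg.1 i).2.2.1) hmdead hg hgX hpl₁ (hU.mono himg) (hD.mono himg) Finset.univ
    have hsurj : Function.Surjective π := Finite.surjective_of_injective hπ
    have hrange : (Set.range fun i => s(x, (ℓ ∘ π) i)) = Set.range fun i => s(x, ℓ i) :=
      hsurj.range_comp fun i => s(x, ℓ i)
    have hverts : ⋃ i ∈ (Finset.univ : Finset (Fin 3)), (t (π i)).verts = ⋃ i, (t i).verts := by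
      simpa using hsurj.iUnion_comp fun i => (t i).verts
    have hedges : ⋃ i ∈ (Finset.univ : Finset (Fin 3)),
        (t (π i)).edges (Function.update ℓ (π i) x) =
          ⋃ i, (t i).edges (Function.update ℓ i x) := by
      simpa using hsurj.iUnion_comp fun i => (t i).edges (Function.update ℓ i x)
    rw [hverts, hedges, hrange] at H₂
    rw [hedges] at hcount
    refine ⟨A₂, hA₁.trans hA₂ (Set.subset_insert _ _) Set.subset_union_left, ?_, ?_⟩
    · have := H₂.mono (X' := X) (U' := U) (D' := D) Set.subset_union_left Set.subset_union_left
        Set.subset_union_left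
      rw [Set.insert_union, ← Set.union_insert, Set.union_assoc] at this
      exact this
    · refine le_trans ?_ hmB
      rw [← Fin.sum_univ_three fun i => (t (π i)).stateBudget (m.next i) (π ∘ m.perm i)]
      refine le_trans ?_ (add_le_add (ncard_biarc_range_le (A := A₁) hk) hcount)
      refine (Set.ncard_le_ncard ?_ (Set.toFinite _)).trans (Set.ncard_union_le _ _)
      rintro e ⟨he | he, hke⟩
      · rw [← hrange] at he
        exact .inl ⟨he, (hA₂.kind_eq e (.inr he)).symm.trans hke⟩
      · exact .inr ⟨he, hke⟩

end ArcDiagram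

/-! ### The face tree of a construction sequence -/

namespace FaceTree

variable {V : Type}

theorem size_eq_ncard_verts [Finite V] : ∀ t : FaceTree V, t.Distinct → t.size = t.verts.ncard
  | leaf, _ => by simp [size, verts]
  | node x t, h => by
    have hx : x ∉ ⋃ i, (t i).verts := by simpa using h.1
    have hU : ⋃ i, (t i).verts = (t 0).verts ∪ ((t 1).verts ∪ (t 2).verts) := by
      ext v; simp [Fin.exists_fin_succ]
    have h12 : Disjoint (t 1).verts (t 2).verts := h.2.1 1 2 (by decide)
    have h0 : Disjoint (t 0).verts ((t 1).verts ∪ (t 2).verts) :=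
      Set.disjoint_union_right.2 ⟨h.2.1 0 1 (by decide), h.2.1 0 2 (by decide)⟩
    rw [size, verts, Set.ncard_insert_of_notMem hx, hU, Set.ncard_union_eq h0,
      Set.ncard_union_eq h12, (t 0).size_eq_ncard_verts (h.2.2 0),
      (t 1).size_eq_ncard_verts (h.2.2 1), (t 2).size_eq_ncard_verts (h.2.2 2)]
    ring

end FaceTree

namespace P3TConstruction

variable {V : Type} [Fintype V] [DecidableEq V] {G : SimpleGraph V} (C : P3TConstruction V G)

/-- The tree `t` records all subdivisions of the face with corners `ℓ`. -/
def Fits : FaceTree V → (Fin 3 → V) → Prop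
  | .leaf, ℓ => ∀ k : Fin C.n, 3 ≤ (k : ℕ) → C.F k ≠ Finset.univ.image ℓ
  | .node x t, ℓ => ∃ k : Fin C.n, 3 ≤ (k : ℕ) ∧ C.ord k = x ∧ C.F k = Finset.univ.image ℓ ∧
      ∀ i, Fits (t i) (Function.update ℓ i x)

variable {C}

theorem symm_lt_of_mem_F {k : Fin C.n} (hk : 3 ≤ (k : ℕ)) {u : V} (hu : u ∈ C.F k) :
    C.ord.symm u < k := by
  obtain ⟨i, hi, rfl⟩ := C.F_sub k hk u hu
  simpa using hi

theorem exists_fits_of_le (d : ℕ) : ∀ ℓ : Fin 3 → V,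
    (∀ k : Fin C.n, 3 ≤ (k : ℕ) → C.F k = Finset.univ.image ℓ → C.n ≤ k + d) →
    ∃ t, C.Fits t ℓ := by
  induction d with
  | zero =>
    intro ℓ h
    exact ⟨.leaf, fun k hk hF => by have := h k hk hF; omega⟩
  | succ d ih =>
    intro ℓ h
    by_cases hex : ∃ k : Fin C.n, 3 ≤ (k : ℕ) ∧ C.F k = Finset.univ.image ℓ
    · obtain ⟨k, hk, hF⟩ := hex
      have hchild : ∀ i, ∃ t, C.Fits t (Function.update ℓ i (C.ord k)) := fun i => by
        refine ih _ fun k' hk' hF' => ?_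
        have hmem : C.ord k ∈ C.F k' := by
          rw [hF', Finset.mem_image]
          exact ⟨i, Finset.mem_univ _, Function.update_self ..⟩
        have hlt := symm_lt_of_mem_F hk' hmem
        have := h k hk hF
        rw [Equiv.symm_apply_apply, Fin.lt_def] at hlt
        omega
      choose t ht using hchild
      exact ⟨.node (C.ord k) t, k, hk, rfl, hF, ht⟩
    · push Not at hex
      exact ⟨.leaf, hex⟩

variable (C) in
theorem exists_fits (ℓ : Fin 3 → V) : ∃ t, C.Fits t ℓ :=
  exists_fits_of_le C.n ℓ fun _ _ _ => Nat.le_add_left _ _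

theorem symm_lt_root {k : Fin C.n} (hk : 3 ≤ (k : ℕ)) {ℓ : Fin 3 → V}
    (hF : C.F k = Finset.univ.image ℓ) (j : Fin 3) : C.ord.symm (ℓ j) < k :=
  symm_lt_of_mem_F hk (hF ▸ Finset.mem_image_of_mem _ (Finset.mem_univ j))

theorem Fits.verts_spec {t : FaceTree V} : ∀ {ℓ : Fin 3 → V}, C.Fits t ℓ → ∀ v ∈ t.verts,
    3 ≤ (C.ord.symm v : ℕ) ∧ ∀ j, C.ord.symm (ℓ j) < C.ord.symm v := by
  induction t with
  | leaf => simp [FaceTree.verts]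
  | node x t ih =>
    rintro ℓ ⟨k, hk, rfl, hF, ht⟩ v (rfl | hv)
    · simpa using ⟨hk, symm_lt_root hk hF⟩
    · obtain ⟨i, hi⟩ := Set.mem_iUnion.1 hv
      obtain ⟨h3, hlt⟩ := ih i (ht i) v hi
      refine ⟨h3, fun j => (symm_lt_root hk hF j).trans ?_⟩
      simpa using hlt i

theorem Fits.exists_parent {t : FaceTree V} : ∀ {ℓ : Fin 3 → V}, C.Fits t ℓ → ∀ v ∈ t.verts,
    C.F (C.ord.symm v) = Finset.univ.image ℓ ∨ ∃ x ∈ t.verts, x ∈ C.F (C.ord.symm v) ∧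
      ∀ u ∈ C.F (C.ord.symm v), C.ord.symm u ≤ C.ord.symm x := by
  induction t with
  | leaf => simp [FaceTree.verts]
  | node x t ih =>
    rintro ℓ ⟨k, hk, rfl, hF, ht⟩ v (rfl | hv)
    · left; simpa using hF
    · right
      obtain ⟨i, hi⟩ := Set.mem_iUnion.1 hv
      rcases ih i (ht i) v hi with h | ⟨x, hx, hxF, hmax⟩
      · refine ⟨C.ord k, Set.mem_insert _ _, ?_, fun u hu => ?_⟩
        · rw [h]
          exact Finset.mem_image.2 ⟨i, Finset.mem_univ _, Function.update_self ..⟩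
        · rw [h] at hu
          obtain ⟨j, -, rfl⟩ := Finset.mem_image.1 hu
          rw [Function.update_apply, Equiv.symm_apply_apply]
          split_ifs
          · simp
          · exact (symm_lt_root hk hF j).le
      · exact ⟨x, .inr (Set.mem_iUnion.2 ⟨i, hx⟩), hxF, hmax⟩

theorem Fits.disjoint_verts {t₁ t₂ : FaceTree V} {ℓ₁ ℓ₂ : Fin 3 → V} (h₁ : C.Fits t₁ ℓ₁)
    (h₂ : C.Fits t₂ ℓ₂) {i₁ i₂ : Fin 3} (heq : ℓ₁ i₁ = ℓ₂ i₂)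
    (hmax₁ : ∀ j, C.ord.symm (ℓ₁ j) ≤ C.ord.symm (ℓ₁ i₁))
    (hmax₂ : ∀ j, C.ord.symm (ℓ₂ j) ≤ C.ord.symm (ℓ₂ i₂))
    (hne : Finset.univ.image ℓ₁ ≠ Finset.univ.image ℓ₂) : Disjoint t₁.verts t₂.verts := by
  have key : ∀ (k : Fin C.n), C.ord k ∈ t₁.verts → C.ord k ∉ t₂.verts := by
    intro k
    induction k using WellFoundedLT.induction with
    | ind k ih =>
      intro hk₁ hk₂
      have h3 := (h₁.verts_spec _ hk₁).1
      have hp₁ := h₁.exists_parent _ hk₁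
      have hp₂ := h₂.exists_parent _ hk₂
      simp only [Equiv.symm_apply_apply] at h3 hp₁ hp₂
      rcases hp₁ with hp₁ | ⟨x, hx, hxF, hxmax⟩ <;> rcases hp₂ with hp₂ | ⟨y, hy, hyF, hymax⟩
      · exact hne (hp₁.symm.trans hp₂)
      · have hlt := (h₂.verts_spec y hy).2 i₂
        rw [hp₁] at hyF
        obtain ⟨j, -, rfl⟩ := Finset.mem_image.1 hyF
        rw [← heq] at hlt
        exact absurd (hmax₁ j) (not_le.2 hlt)
      · have hlt := (h₁.verts_spec x hx).2 i₁
        rw [hp₂] at hxF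
        obtain ⟨j, -, rfl⟩ := Finset.mem_image.1 hxF
        rw [heq] at hlt
        exact absurd (hmax₂ j) (not_le.2 hlt)
      · have hxy : x = y := C.ord.symm.injective (le_antisymm (hymax x hxF) (hxmax y hyF))
        subst hxy
        exact ih _ (symm_lt_of_mem_F h3 hxF) (by simpa using hx) (by simpa using hy)
  refine Set.disjoint_left.2 fun v hv => ?_
  simpa using key (C.ord.symm v) (by simpa using hv)

theorem Fits.corner_ne {x : V} {t : Fin 3 → FaceTree V} {ℓ : Fin 3 → V}
    (h : C.Fits (.node x t) ℓ) (j : Fin 3) : ℓ j ≠ x := fun hj =>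
  ((h.verts_spec x (Set.mem_insert _ _)).2 j).ne (congrArg _ hj)

theorem Fits.distinct {t : FaceTree V} : ∀ {ℓ : Fin 3 → V}, C.Fits t ℓ → Function.Injective ℓ →
    t.Distinct := by
  induction t with
  | leaf => intros; trivial
  | node x t ih =>
    intro ℓ h hℓ
    have hlt := (h.verts_spec x (Set.mem_insert _ _)).2
    have hne := h.corner_ne
    obtain ⟨k, hk, hkx, hF, ht⟩ := h
    have hmax : ∀ i j, C.ord.symm (Function.update ℓ i x j) ≤
        C.ord.symm (Function.update ℓ i x i) := by
      intro i j
      rw [Function.update_self, Function.update_apply]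
      split_ifs
      exacts [le_rfl, (hlt j).le]
    refine ⟨fun i hi => ?_, fun i j hij => ?_, fun i =>
      ih i (ht i) (hℓ.update_of_forall_ne hne i)⟩
    · exact absurd (((ht i).verts_spec x hi).2 i) (by simp)
    · refine (ht i).disjoint_verts (ht j) (i₁ := i) (i₂ := j) (by simp) (hmax i) (hmax j) ?_
      intro heq
      have hmem : ℓ i ∈ Finset.univ.image (Function.update ℓ j x) :=
        Finset.mem_image.2 ⟨i, Finset.mem_univ _, Function.update_of_ne hij _ _⟩
      rw [← heq] at hmem
      obtain ⟨a, -, ha⟩ := Finset.mem_image.1 hmem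
      rw [Function.update_apply] at ha
      split_ifs at ha with hai
      · exact hne i ha.symm
      · exact hai (hℓ ha)

theorem Fits.ord_mem_of_F_eq {t : FaceTree V} {ℓ : Fin 3 → V} (h : C.Fits t ℓ) {k : Fin C.n}
    (hk : 3 ≤ (k : ℕ)) (hF : C.F k = Finset.univ.image ℓ) : C.ord k ∈ t.verts := by
  cases t with
  | leaf => exact absurd hF (h k hk)
  | node x t =>
    obtain ⟨k', hk', rfl, hF', -⟩ := h
    rw [C.F_inj k k' hk hk' (hF.trans hF'.symm)]
    exact Set.mem_insert _ _

theorem Fits.ord_mem_of_child {t : FaceTree V} {i k : Fin C.n} (hk : 3 ≤ (k : ℕ)) {y : V}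
    (hy : y ∈ C.F i) (hF : C.F k = insert (C.ord i) ((C.F i).erase y)) :
    ∀ {ℓ : Fin 3 → V}, C.Fits t ℓ → Function.Injective ℓ → C.ord i ∈ t.verts →
      C.ord k ∈ t.verts := by
  induction t with
  | leaf => simp [FaceTree.verts]
  | node x t ih =>
    intro ℓ h hℓ hi
    have hne := h.corner_ne
    obtain ⟨k', hk', hkx, hF', ht⟩ := h
    right
    rcases hi with hi | hi
    · obtain rfl : i = k' := C.ord.injective (hi.trans hkx.symm)
      rw [hF'] at hy
      obtain ⟨a, -, rfl⟩ := Finset.mem_image.1 hy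
      refine Set.mem_iUnion.2 ⟨a, (ht a).ord_mem_of_F_eq hk ?_⟩
      rw [hF, hF', Finset.image_update_univ hℓ, hkx]
    · obtain ⟨a, ha⟩ := Set.mem_iUnion.1 hi
      exact Set.mem_iUnion.2 ⟨a, ih a (ht a) (hℓ.update_of_forall_ne hne a) ha⟩

theorem Fits.ord_mem {t : FaceTree V} {ℓ : Fin 3 → V} (h : C.Fits t ℓ)
    (hℓ : Function.Injective ℓ) (hroot : Finset.univ.image ℓ = C.rootFace) (k : Fin C.n)
    (hk : 3 ≤ (k : ℕ)) : C.ord k ∈ t.verts := by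
  induction k using WellFoundedLT.induction with
  | ind k ih =>
    rcases C.F_created k hk with hF | ⟨i, hik, hi, y, hy, hF⟩
    · exact h.ord_mem_of_F_eq hk (hF.trans hroot.symm)
    · exact h.ord_mem_of_child hk hy hF hℓ (ih i hik hi)

theorem Fits.mem_edges {t : FaceTree V} {k : Fin C.n} {u : V} (hu : u ∈ C.F k) :
    ∀ {ℓ : Fin 3 → V}, C.Fits t ℓ → C.ord k ∈ t.verts → s(C.ord k, u) ∈ t.edges ℓ := by
  induction t with
  | leaf => simp [FaceTree.verts]
  | node x t ih =>
    rintro ℓ ⟨k', hk', hkx, hF', ht⟩ (hv | hv)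
    · obtain rfl : k = k' := C.ord.injective (hv.trans hkx.symm)
      rw [hF'] at hu
      obtain ⟨a, -, rfl⟩ := Finset.mem_image.1 hu
      exact .inl ⟨a, by rw [hkx]⟩
    · obtain ⟨a, ha⟩ := Set.mem_iUnion.1 hv
      exact .inr (Set.mem_iUnion.2 ⟨a, ih a (ht a) ha⟩)

variable (C)

/-- The corners of the root face. -/
def rootCorner (i : Fin 3) : V := C.ord (i.castLE C.three_le)

theorem injective_rootCorner : Function.Injective C.rootCorner :=
  C.ord.injective.comp (Fin.castLE_injective _)

theorem image_rootCorner : Finset.univ.image C.rootCorner = C.rootFace := by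
  ext v
  simp [Fin.exists_fin_succ, rootCorner, rootFace, Fin.castLE, eq_comm]

variable {C}

theorem Fits.univ_eq {t : FaceTree V} (h : C.Fits t C.rootCorner) :
    Set.range C.rootCorner ∪ t.verts = Set.univ := by
  refine Set.eq_univ_of_forall fun v => ?_
  obtain ⟨k, rfl⟩ := C.ord.surjective v
  rcases lt_or_ge (k : ℕ) 3 with hk | hk
  · exact .inl ⟨⟨k, hk⟩, rfl⟩
  · exact .inr (h.ord_mem C.injective_rootCorner C.image_rootCorner k hk)

theorem Fits.edgeSet_subset {t : FaceTree V} (h : C.Fits t C.rootCorner) :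
    G.edgeSet ⊆ {e | ∃ i j, i < j ∧ e = s(C.rootCorner i, C.rootCorner j)} ∪
      t.edges C.rootCorner := by
  have key : ∀ i j : Fin C.n, i < j → G.Adj (C.ord i) (C.ord j) → s(C.ord i, C.ord j) ∈
      {e | ∃ i j, i < j ∧ e = s(C.rootCorner i, C.rootCorner j)} ∪ t.edges C.rootCorner := by
    intro i j hij hadj
    rcases lt_or_ge (j : ℕ) 3 with hj | hj
    · exact .inl ⟨⟨i, Nat.lt_trans hij hj⟩, ⟨j, hj⟩, hij, rfl⟩
    · right
      rw [Sym2.eq_swap]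
      exact Fits.mem_edges ((C.adj_ins j hj i hij).1 hadj) h
        (h.ord_mem C.injective_rootCorner C.image_rootCorner j hj)
  intro e he
  induction e with
  | h a b =>
    obtain ⟨i, rfl⟩ := C.ord.surjective a
    obtain ⟨j, rfl⟩ := C.ord.surjective b
    have hadj : G.Adj (C.ord i) (C.ord j) := he
    rcases lt_trichotomy i j with hij | rfl | hij
    · exact key i j hij hadj
    · exact absurd rfl hadj.ne
    · rw [Sym2.eq_swap]
      exact key j i hij hadj.symm

theorem Fits.disjoint_range {t : FaceTree V} {ℓ : Fin 3 → V} (h : C.Fits t ℓ) :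
    Disjoint t.verts (Set.range ℓ) := by
  refine Set.disjoint_left.2 ?_
  rintro v hv ⟨j, rfl⟩
  exact lt_irrefl _ ((h.verts_spec _ hv).2 j)

theorem Fits.size_add_three_le {t : FaceTree V} {ℓ : Fin 3 → V} (h : C.Fits t ℓ)
    (hℓ : Function.Injective ℓ) : t.size + 3 ≤ Fintype.card V := by
  have hr : (Set.range ℓ).ncard = 3 := by
    rw [← Set.image_univ, Set.ncard_image_of_injective _ hℓ]; simp
  rw [t.size_eq_ncard_verts (h.distinct hℓ), ← hr, ← Set.ncard_union_eq h.disjoint_range,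
    ← Nat.card_eq_fintype_card, ← Set.ncard_univ]
  exact Set.ncard_le_ncard (Set.subset_univ _)

end P3TConstruction

/-! ### The main theorem -/

namespace ArcDiagram

variable {V : Type}

/-- The edges of the triangle with corners `ℓ`. -/
def triangleEdges (ℓ : Fin 3 → V) : Set (Sym2 V) := {e | ∃ i j, i < j ∧ e = s(ℓ i, ℓ j)}

theorem mem_triangleEdges {ℓ : Fin 3 → V} {e : Sym2 V} :
    e ∈ triangleEdges ℓ ↔ e = s(ℓ 0, ℓ 1) ∨ e = s(ℓ 0, ℓ 2) ∨ e = s(ℓ 1, ℓ 2) := by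
  constructor
  · rintro ⟨i, j, hij, rfl⟩
    fin_cases i <;> fin_cases j <;> simp at hij ⊢
  · rintro (rfl | rfl | rfl)
    exacts [⟨0, 1, by decide, rfl⟩, ⟨0, 2, by decide, rfl⟩, ⟨1, 2, by decide, rfl⟩]

/-- A triangle with two mountains and one pocket, with a gap in the middle of the pocket. -/
theorem exists_draws_triangle [DecidableEq V] {ℓ : Fin 3 → V} (hℓ : Function.Injective ℓ) :
    ∃ A : ArcDiagram V, (∀ e ∈ triangleEdges ℓ, A.kind e ≠ .biarc) ∧
      GapMove.Placed ⟨.tentLeft, false⟩ (A.pos ∘ ℓ) (3 / 2) ∧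
      A.Draws (Set.range ℓ) (triangleEdges ℓ) {3 / 2}
        (sightArcs (GapState.up ⟨.tentLeft, false⟩) (A.pos ∘ ℓ) (3 / 2))
        (sightArcs (GapState.down ⟨.tentLeft, false⟩) (A.pos ∘ ℓ) (3 / 2)) := by
  let A : ArcDiagram V :=
    { pos := Function.extend ℓ (fun i => ((i : ℕ) : ℝ)) 0
      kind := fun e => if e = s(ℓ 1, ℓ 2) then .pocket else .mountain
      crossPt := 0
      credit := 0 }
  have hpos : ∀ i, A.pos (ℓ i) = ((i : ℕ) : ℝ) := fun i =>
    hℓ.extend_apply (fun i => ((i : ℕ) : ℝ)) 0 i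
  have hp0 : A.pos (ℓ 0) = 0 := by simp [hpos]
  have hp1 : A.pos (ℓ 1) = 1 := by simp [hpos]
  have hp2 : A.pos (ℓ 2) = 2 := by simp [hpos]
  have h01 : ℓ 0 ≠ ℓ 1 := hℓ.ne (by decide)
  have h02 : ℓ 0 ≠ ℓ 2 := hℓ.ne (by decide)
  have hk01 : A.kind s(ℓ 0, ℓ 1) = .mountain := if_neg (by simp [h01, h02])
  have hk02 : A.kind s(ℓ 0, ℓ 2) = .mountain := if_neg (by simp [h01, h02])
  have hk12 : A.kind s(ℓ 1, ℓ 2) = .pocket := if_pos rfl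
  have hkind : ∀ e ∈ triangleEdges ℓ, A.kind e ≠ .biarc := by
    intro e he
    rcases mem_triangleEdges.1 he with rfl | rfl | rfl
    · simp [hk01]
    · simp [hk02]
    · simp [hk12]
  have hcomp : A.pos ∘ ℓ = ![0, 1, 2] := by
    funext i
    fin_cases i
    exacts [hp0, hp1, hp2]
  refine ⟨A, hkind, ?_, ?_⟩
  · rw [hcomp]
    refine ⟨show (0 : ℝ) < 1 ∧ (1 : ℝ) < 2 by norm_num, fun j => ?_⟩
    fin_cases j <;> norm_num [GapState.left, GapShape.left]
  · refine ⟨?_, Set.finite_singleton _, ?_, ?_, fun e he hk => absurd hk (hkind e he),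
      fun e he f _ _ hk => absurd hk (hkind e he), ?_, ?_⟩
    · rintro e ⟨i, j, -, rfl⟩ v hv
      rcases Sym2.mem_iff.1 hv with rfl | rfl <;> exact ⟨_, rfl⟩
    · rintro _ ⟨i, rfl⟩ _ ⟨j, rfl⟩ hij
      rw [hpos, hpos, Nat.cast_inj, Fin.val_inj] at hij
      rw [hij]
    · rintro _ ⟨i, rfl⟩ hi
      rw [hpos, Set.mem_singleton_iff] at hi
      fin_cases i <;> norm_num at hi
    · have hsub : A.upperSet (triangleEdges ℓ) ∪
          sightArcs (GapState.up ⟨.tentLeft, false⟩) (A.pos ∘ ℓ) (3 / 2) ⊆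
          {(0, 1), (0, 2), (0, 3 / 2), (1, 3 / 2), (3 / 2, 2)} := by
        rw [hcomp]
        rintro p (⟨e, he, hp⟩ | ⟨j, hj, rfl⟩)
        · rcases mem_triangleEdges.1 he with rfl | rfl | rfl
          · simp [upperArcs, hk01, lo, hi, hp0, hp1] at hp; simp [hp]
          · simp [upperArcs, hk02, lo, hi, hp0, hp2] at hp; simp [hp]
          · simp [upperArcs, hk12] at hp
        · fin_cases j <;> norm_num [min_def, max_def]
      refine NonCrossing.mono (fun p hp q hq => ?_) hsub
      simp only [Set.mem_insert_iff, Set.mem_singleton_iff] at hp hq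
      rcases hp with rfl | rfl | rfl | rfl | rfl <;> rcases hq with rfl | rfl | rfl | rfl | rfl <;>
        norm_num [Interleaved]
    · have hsub : A.lowerSet (triangleEdges ℓ) ∪
          sightArcs (GapState.down ⟨.tentLeft, false⟩) (A.pos ∘ ℓ) (3 / 2) ⊆
          {(1, 2), (1, 3 / 2), (3 / 2, 2)} := by
        rw [hcomp]
        rintro p (⟨e, he, hp⟩ | ⟨j, hj, rfl⟩)
        · rcases mem_triangleEdges.1 he with rfl | rfl | rfl
          · simp [lowerArcs, hk01] at hp
          · simp [lowerArcs, hk02] at hp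
          · simp [lowerArcs, hk12, lo, hi, hp1, hp2] at hp; simp [hp]
        · fin_cases j
          · simp [GapState.down, GapShape.down] at hj
          all_goals norm_num [min_def, max_def]
      refine NonCrossing.mono (fun p hp q hq => ?_) hsub
      simp only [Set.mem_insert_iff, Set.mem_singleton_iff] at hp hq
      rcases hp with rfl | rfl | rfl <;> rcases hq with rfl | rfl | rfl <;>
        norm_num [Interleaved]

theorem Draws.isPlaneOn {A : ArcDiagram V} {E : Set (Sym2 V)} {X : Set ℝ} {U D : Set (ℝ × ℝ)}
    {G : SimpleGraph V} (H : A.Draws Set.univ E X U D) (hE : G.edgeSet ⊆ E) :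
    A.IsPlaneOn G Set.univ := by
  refine ⟨H.injOn_pos, fun e he hk => ?_, fun e he f hf => H.cross_ne e (hE he.1) f (hE hf.1),
    fun e he f hf _ => ⟨fun p hp q hq => ?_, fun p hp q hq => ?_⟩⟩
  · obtain ⟨h1, h2, h3, -⟩ := H.cross e (hE he.1) hk
    exact ⟨h1, h2, h3⟩
  · exact H.upper p (.inl ⟨e, hE he.1, hp⟩) q (.inl ⟨f, hE hf.1, hq⟩)
  · exact H.lower p (.inl ⟨e, hE he.1, hp⟩) q (.inl ⟨f, hE hf.1, hq⟩)

end ArcDiagram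

/-- Every planar 3-tree on `n` vertices admits a plane arc diagram
with at most `⌊3(n-3)/4⌋` biarcs, where every biarc is a down-up monotone biarc. -/
theorem planar_three_tree_arc_diagram_few_biarcs {V : Type} [Fintype V] [DecidableEq V]
    (G : SimpleGraph V) (hpl : IsPlanar G) (hC : Nonempty (P3TConstruction V G)) :
    ∃ A : ArcDiagram V, A.IsPlaneOn G Set.univ ∧
      A.biarcCount G Set.univ ≤ 3 * (Fintype.card V - 3) / 4 := by
  obtain ⟨C⟩ := hC
  have hℓ := C.injective_rootCorner
  obtain ⟨t, ht⟩ := C.exists_fits C.rootCorner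
  obtain ⟨A, hkind, hplaced, H⟩ := ArcDiagram.exists_draws_triangle hℓ
  obtain ⟨B, hAB, HB, hcount⟩ := ArcDiagram.fillable t A _ _ ∅ ∅ ∅ C.rootCorner id
    ⟨.tentLeft, false⟩ (3 / 2) (ht.distinct hℓ) ht.disjoint_range hℓ Set.mem_range_self
    Function.injective_id (by simp) (fun _ => hplaced) (Set.notMem_empty _)
    (fun _ h => h.elim) (fun _ h => h.elim) (by simpa using H)
  rw [ht.univ_eq] at HB
  refine ⟨B, HB.isPlaneOn ht.edgeSet_subset, ?_⟩
  have hsize := ht.size_add_three_le hℓ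
  have hbudget := t.budget_le
  have hle : B.biarcCount G Set.univ ≤ t.budget.1 := by
    refine (Set.ncard_le_ncard ?_ (Set.toFinite _)).trans hcount
    rintro e ⟨he, hk⟩
    refine ⟨(ht.edgeSet_subset he.1).resolve_left fun htri => hkind e htri ?_, hk⟩
    rw [← hAB.kind_eq e htri, hk]
  omega
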